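/- arXiv:1204.5029 — 3 statements merged into one kernel-verified Lean document; each statement's English description precedes it below -/
import Mathlib

section
/- Let d ≥ 1, let a, b > 0, let Λ = aℤ^d × bℤ^d, and let g ∈ 𝒮(ℝ^d) be a Schwartz function such that the function (UV_g g)(ξ,x) = V_g g(−x,ξ) does not vanish at any point of the closed rectangle [−1/(2a), 1/(2a)]^d × [−1/(2b), 1/(2b)]^d. Let σ ∈ 𝒮′(ℝ^{2d}) be a tempered distribution whose distributional Fourier transform σ̂ is supported in Q_ε = [−1/(2a)+ε, 1/(2a)−ε]^d × [−1/(2b)+ε, 1/(2b)−ε]^d for some ε > 0 (i.e. σ̂ annihilates every Schwartz function whose support is disjoint from Q_ε). Then there exists a kernel K ∈ 𝒮(ℝ^{2d}) such that σ = Σ_{λ∈Λ} H_{λλ} T_λ K with convergence in 𝒮′(ℝ^{2d}); that is, for every test function φ ∈ 𝒮(ℝ^{2d}), the family λ ↦ H_{λλ}·⟨T_λ K, φ⟩ is summable over Λ with sum ⟨σ, φ⟩, where H_{λλ} = ⟨σ, R(π(λ)g, π(λ)g)⟩ is the value of σ at the (conjugate of the) Schwartz function R(π(λ)g, π(λ)g).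 -/
noncomputable section

open MeasureTheory Complex Filter Real
open scoped FourierTransform Convolution Topology ENNReal

/-- first `d` coordinates of a point of ℝ^{d+d} -/
def zx {d : ℕ} (z : EuclideanSpace ℝ (Fin (d + d))) : EuclideanSpace ℝ (Fin d) :=
  (EuclideanSpace.equiv (Fin d) ℝ).symm fun i => z (Fin.castAdd d i)

/-- last `d` coordinates of a point of ℝ^{d+d} -/
def zxi {d : ℕ} (z : EuclideanSpace ℝ (Fin (d + d))) : EuclideanSpace ℝ (Fin d) :=
  (EuclideanSpace.equiv (Fin d) ℝ).symm fun i => z (Fin.natAdd d i)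

/-- build a point of ℝ^{d+d} from two points of ℝ^d -/
def mk2 {d : ℕ} (x ξ : EuclideanSpace ℝ (Fin d)) : EuclideanSpace ℝ (Fin (d + d)) :=
  (EuclideanSpace.equiv (Fin (d + d)) ℝ).symm fun i =>
    Sum.elim (fun j => x j) (fun j => ξ j) (finSumFinEquiv.symm i)

/-- the vector (a k₁, …, a k_d) ∈ ℝ^d for k ∈ ℤ^d -/
def vecd {d : ℕ} (a : ℝ) (k : Fin d → ℤ) : EuclideanSpace ℝ (Fin d) :=
  (EuclideanSpace.equiv (Fin d) ℝ).symm fun i => a * (k i : ℝ)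

/-- time-frequency shift π(x,ξ) f (t) = e^{2πi ξ·t} f(t-x) -/
def tf {d : ℕ} (x ξ : EuclideanSpace ℝ (Fin d)) (f : EuclideanSpace ℝ (Fin d) → ℂ) :
    EuclideanSpace ℝ (Fin d) → ℂ :=
  fun t => Complex.exp (2 * Real.pi * Complex.I * (inner ℝ ξ t : ℝ)) * f (t - x)

/-- short-time Fourier transform V_g f(x, ξ) = ∫ f(t) conj(g(t-x)) e^{-2πi ξ·t} dt -/
def stft {d : ℕ} (g f : EuclideanSpace ℝ (Fin d) → ℂ) (x ξ : EuclideanSpace ℝ (Fin d)) : ℂ :=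
  ∫ t, f t * (starRingEnd ℂ) (g (t - x)) *
    Complex.exp (-(2 * Real.pi * Complex.I) * (inner ℝ ξ t : ℝ))

/-- Rihaczek distribution R(f,g)(x,ξ) = f(x) conj(ĝ(ξ)) e^{-2πi x·ξ},
as a function on ℝ^{d+d} with variable z = (x, ξ) -/
def rihaczek {d : ℕ} (f g : EuclideanSpace ℝ (Fin d) → ℂ)
    (z : EuclideanSpace ℝ (Fin (d + d))) : ℂ :=
  f (zx z) * (starRingEnd ℂ) (𝓕 g (zxi z)) *
    Complex.exp (-(2 * Real.pi * Complex.I) * (inner ℝ (zx z) (zxi z) : ℝ))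

/-- (𝒰 V_g g)(ξ, x) = V_g g(-x, ξ), as a function on ℝ^{d+d} with variable z = (ξ, x) -/
def UVgg {d : ℕ} (g : EuclideanSpace ℝ (Fin d) → ℂ)
    (z : EuclideanSpace ℝ (Fin (d + d))) : ℂ :=
  stft g g (-(zxi z)) (zx z)

/-- the point (a k, b l) of the lattice Λ = aℤ^d × bℤ^d, as a point of ℝ^{d+d} -/
def lat {d : ℕ} (a b : ℝ) (kl : (Fin d → ℤ) × (Fin d → ℤ)) :
    EuclideanSpace ℝ (Fin (d + d)) :=
  mk2 (vecd a kl.1) (vecd b kl.2)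

/-- one-dimensional normalized sinc: t ↦ sin(πct)/(πct), equal to 1 at t = 0 -/
def sinc1 (c t : ℝ) : ℝ :=
  if t = 0 then 1 else Real.sin (Real.pi * c * t) / (Real.pi * c * t)

/-- the sinc function on ℝ^{d+d} adapted to the lattice aℤ^d × bℤ^d -/
def sincL {d : ℕ} (a b : ℝ) (z : EuclideanSpace ℝ (Fin (d + d))) : ℂ :=
  ((∏ i, sinc1 a (zx z i)) * ∏ i, sinc1 b (zxi z i) : ℝ)

/-- the closed box [-1/(2a)+ε, 1/(2a)-ε]^d × [-1/(2b)+ε, 1/(2b)-ε]^d ⊆ ℝ^{d+d};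
for ε = 0 this is the box Q = [-1/(2a), 1/(2a)]^d × [-1/(2b), 1/(2b)]^d -/
def Qbox {d : ℕ} (a b ε : ℝ) : Set (EuclideanSpace ℝ (Fin (d + d))) :=
  {z | (∀ i, |zx z i| ≤ 1 / (2 * a) - ε) ∧ (∀ i, |zxi z i| ≤ 1 / (2 * b) - ε)}

/-- diagonal entry H_{λλ} = ⟨σ^{KN} π(λ)g, π(λ)g⟩ = ∫ σ(z) conj(R(π(λ)g,π(λ)g)(z)) dz
of the channel matrix of a (locally integrable) symbol σ, at λ = (a k, b l) -/
def Hdiag {d : ℕ} (σ : EuclideanSpace ℝ (Fin (d + d)) → ℂ)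
    (g : EuclideanSpace ℝ (Fin d) → ℂ) (a b : ℝ) (kl : (Fin d → ℤ) × (Fin d → ℤ)) : ℂ :=
  ∫ z, σ z * (starRingEnd ℂ)
    (rihaczek (tf (vecd a kl.1) (vecd b kl.2) g) (tf (vecd a kl.1) (vecd b kl.2) g) z)

namespace SchwartzMap

variable {ι V F : Type*} [NormedAddCommGroup V] [NormedSpace ℝ V]
  [NormedAddCommGroup F] [NormedSpace ℝ F]

/-- A family of Schwartz functions all of whose seminorms are summable is summable in the Schwartz
topology. -/
theorem summable_of_summable_seminorm [CompleteSpace F] (f : ι → SchwartzMap V F)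
    (hf : ∀ k l, Summable fun i => SchwartzMap.seminorm ℝ k l (f i)) : Summable f := by
  have hbound (l : ℕ) (i : ι) (x : V) :
      ‖iteratedFDeriv ℝ l (f i) x‖ ≤ SchwartzMap.seminorm ℝ 0 l (f i) :=
    norm_iteratedFDeriv_le_seminorm ℝ (f i) l x
  have hderiv (T : Set ι) (l : ℕ) (x : V) :
      iteratedFDeriv ℝ l (fun y => ∑' i : T, f i y) x = ∑' i : T, iteratedFDeriv ℝ l (f i) x :=
    iteratedFDeriv_tsum_apply (N := (⊤ : ℕ∞)) (f := fun (i : T) x => f i x)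
      (v := fun l (i : T) => SchwartzMap.seminorm ℝ 0 l (f i)) (fun i => (f i).smooth ⊤)
      (fun l _ => (hf 0 l).subtype T) (fun l i x _ => hbound l i x) le_top x
  have hdecay (T : Set ι) (k l : ℕ) (x : V) :
      ‖x‖ ^ k * ‖iteratedFDeriv ℝ l (fun y => ∑' i : T, f i y) x‖ ≤
        ∑' i : T, SchwartzMap.seminorm ℝ k l (f i) := by
    have hs : Summable fun i : T => ‖iteratedFDeriv ℝ l (f i) x‖ :=
      .of_nonneg_of_le (fun _ => norm_nonneg _) (fun i => hbound l i x) ((hf 0 l).subtype T)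
    rw [hderiv]
    calc ‖x‖ ^ k * ‖∑' i : T, iteratedFDeriv ℝ l (f i) x‖
        ≤ ‖x‖ ^ k * ∑' i : T, ‖iteratedFDeriv ℝ l (f i) x‖ := by
          gcongr
          exact norm_tsum_le_tsum_norm hs
      _ = ∑' i : T, ‖x‖ ^ k * ‖iteratedFDeriv ℝ l (f i) x‖ := tsum_mul_left.symm
      _ ≤ _ := (hs.mul_left _).tsum_le_tsum (fun i => le_seminorm ℝ k l (f i) x)
          ((hf k l).subtype T)
  let S (T : Set ι) : SchwartzMap V F :=
    { toFun := fun y => ∑' i : T, f i y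
      smooth' := contDiff_tsum (N := (⊤ : ℕ∞)) (f := fun (i : T) x => f i x)
        (v := fun l (i : T) => SchwartzMap.seminorm ℝ 0 l (f i)) (fun i => (f i).smooth ⊤)
        (fun l _ => (hf 0 l).subtype T) (fun l i x _ => hbound l i x)
      decay' := fun k l => ⟨_, hdecay T k l⟩ }
  have hpoint (x : V) : Summable fun i => f i x := by
    refine .of_norm_bounded (hf 0 0) fun i => ?_
    simpa using hbound 0 i x
  refine ⟨S Set.univ, ?_⟩
  rw [HasSum, SummationFilter.unconditional_filter,
    (schwartz_withSeminorms ℝ V F).tendsto_nhds]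
  rintro ⟨k, l⟩ ε hε
  have htail := tendsto_tsum_compl_atTop_zero fun i => SchwartzMap.seminorm ℝ k l (f i)
  filter_upwards [htail.eventually (gt_mem_nhds hε)] with s hs
  have hS : ∑ i ∈ s, f i - S Set.univ = -S (fun i => i ∉ s) := by
    rw [← neg_sub, neg_inj, sub_eq_iff_eq_add]
    ext x
    have h := (hpoint x).sum_add_tsum_subtype_compl s
    rw [add_apply, sum_apply, add_comm]
    refine Eq.trans (tsum_univ fun i => f i x) ?_
    exact h.symm
  rw [hS, schwartzSeminormFamily_apply, map_neg_eq_map]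
  refine lt_of_le_of_lt ?_ hs
  exact seminorm_le_bound ℝ k l _ (tsum_nonneg fun i => apply_nonneg _ _) (hdecay _ k l)

theorem exists_seminorm_compSubConstCLM_le (f : SchwartzMap V F) (k l : ℕ) :
    ∃ C, 0 ≤ C ∧ ∀ a : V,
      SchwartzMap.seminorm ℝ k l (f.compSubConstCLM ℝ a) ≤ (1 + ‖a‖) ^ k * C := by
  refine ⟨2 ^ k * ((Finset.Iic (k, l)).sup fun m => SchwartzMap.seminorm ℝ m.1 m.2) f,
    by positivity, fun a => seminorm_le_bound ℝ k l _ (by positivity) fun x => ?_⟩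
  have h := one_add_le_sup_seminorm_apply (𝕜 := ℝ) (m := (k, l)) le_rfl le_rfl f (x - a)
  have hcoe : ⇑(f.compSubConstCLM ℝ a) = fun y => f (y - a) := rfl
  have hx : ‖x‖ ≤ (1 + ‖a‖) * (1 + ‖x - a‖) := by
    have h1 : ‖x‖ ≤ ‖x - a‖ + ‖a‖ := by simpa using norm_add_le (x - a) a
    nlinarith [norm_nonneg a, norm_nonneg (x - a)]
  rw [hcoe, iteratedFDeriv_comp_sub]
  calc ‖x‖ ^ k * ‖iteratedFDeriv ℝ l f (x - a)‖
      ≤ ((1 + ‖a‖) * (1 + ‖x - a‖)) ^ k * ‖iteratedFDeriv ℝ l f (x - a)‖ := by gcongr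
    _ = (1 + ‖a‖) ^ k * ((1 + ‖x - a‖) ^ k * ‖iteratedFDeriv ℝ l f (x - a)‖) := by
        rw [mul_pow, mul_assoc]
    _ ≤ _ := by gcongr

theorem exists_one_add_norm_pow_mul_le (f : SchwartzMap V F) (k : ℕ) :
    ∃ C, 0 ≤ C ∧ ∀ x, (1 + ‖x‖) ^ k * ‖f x‖ ≤ C := by
  refine ⟨2 ^ k * ((Finset.Iic (k, 0)).sup fun m => SchwartzMap.seminorm ℝ m.1 m.2) f,
    by positivity, fun x => ?_⟩
  simpa using one_add_le_sup_seminorm_apply (𝕜 := ℝ) (m := (k, 0)) le_rfl le_rfl f x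

end SchwartzMap

/-- A linear change of variables rescales integrals by a positive constant. -/
theorem ContinuousLinearEquiv.exists_integral_comp_eq {V W : Type*} [NormedAddCommGroup V]
    [NormedSpace ℝ V] [MeasureSpace V] [BorelSpace V] [(volume : Measure V).IsAddHaarMeasure]
    [NormedAddCommGroup W] [NormedSpace ℝ W] [FiniteDimensional ℝ W] [MeasureSpace W]
    [BorelSpace W] [(volume : Measure W).IsAddHaarMeasure] (L : V ≃L[ℝ] W) :
    ∃ v : ℝ, 0 < v ∧ (∀ H : W → ℂ, ∫ x, H (L x) = v * ∫ w, H w) ∧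
      ∀ H : W → ℂ, Integrable H → Integrable fun x => H (L x) := by
  have : (Measure.map L volume).IsAddHaarMeasure := L.isAddHaarMeasure_map volume
  have hmap := Measure.isAddLeftInvariant_eq_smul (Measure.map L volume) volume
  have hL : MeasurableEmbedding L := L.toHomeomorph.measurableEmbedding
  refine ⟨Measure.addHaarScalarFactor (Measure.map L volume) volume,
    Measure.addHaarScalarFactor_pos_of_isAddHaarMeasure _ _, fun H => ?_, fun H hH => ?_⟩
  · rw [← hL.integral_map H, ← Complex.real_smul, ← NNReal.smul_def,
      ← integral_smul_nnreal_measure, ← hmap]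
  · refine hL.integrable_map_iff.1 ?_
    rw [hmap]
    exact hH.smul_measure_nnreal

section Lattice

variable {N : ℕ}

/-- The point `(c₁ n₁, …, c_N n_N)` of the rectangular lattice with side lengths `c`. -/
def latticePoint (c : Fin N → ℝ) (n : Fin N → ℤ) : EuclideanSpace ℝ (Fin N) :=
  WithLp.toLp 2 fun i => c i * n i

theorem summable_inv_one_add_mul_sq {c : ℝ} (hc : 0 < c) :
    Summable fun n : ℤ => (1 + (c * n) ^ 2)⁻¹ := by
  have h := ((Real.summable_one_div_int_pow (p := 2)).2 one_lt_two).mul_left ((c ^ 2)⁻¹)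
  refine Summable.of_norm_bounded_eventually h ?_
  have : ∀ᶠ n : ℤ in cofinite, n ≠ 0 := (Set.finite_singleton (0 : ℤ)).compl_mem_cofinite
  filter_upwards [this] with n hn
  have hn' : (n : ℝ) ≠ 0 := by exact_mod_cast hn
  rw [Real.norm_of_nonneg (by positivity), one_div, ← mul_inv, ← mul_pow]
  gcongr
  linarith

theorem summable_pi_prod_of_nonneg {N : ℕ} (f : Fin N → ℤ → ℝ) (h0 : ∀ i n, 0 ≤ f i n)
    (hf : ∀ i, Summable (f i)) : Summable fun n : Fin N → ℤ => ∏ i, f i (n i) := by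
  induction N with
  | zero => exact Summable.of_finite
  | succ N ih =>
    have h := (hf 0).mul_of_nonneg (ih (fun i => f i.succ) (fun i => h0 _) fun i => hf _)
      (h0 0) fun n => Finset.prod_nonneg fun i _ => h0 _ _
    rw [← (Fin.consEquiv fun _ => ℤ).summable_iff]
    refine h.congr fun p => ?_
    simp [Fin.prod_univ_succ, Fin.consEquiv]

theorem summable_inv_one_add_norm_latticePoint {c : Fin N → ℝ} (hc : ∀ i, 0 < c i) :
    Summable fun n => ((1 + ‖latticePoint c n‖) ^ (2 * N))⁻¹ := by
  refine .of_nonneg_of_le (fun n => by positivity) (fun n => ?_)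
    (summable_pi_prod_of_nonneg (fun i n => (1 + (c i * n) ^ 2)⁻¹) (fun i n => by positivity)
      fun i => summable_inv_one_add_mul_sq (hc i))
  rw [Finset.prod_inv_distrib]
  gcongr
  rw [pow_mul]
  have hcard : ((1 + ‖latticePoint c n‖) ^ 2) ^ N =
      ∏ _i : Fin N, (1 + ‖latticePoint c n‖) ^ 2 := by simp
  rw [hcard]
  refine Finset.prod_le_prod (fun i _ => by positivity) fun i _ => ?_
  have h : |c i * n i| ≤ ‖latticePoint c n‖ := PiLp.norm_apply_le (latticePoint c n) i
  rw [← sq_abs (c i * n i)]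
  nlinarith [abs_nonneg (c i * (n i : ℝ)), norm_nonneg (latticePoint c n)]

theorem summable_norm_schwartz_latticePoint {c : Fin N → ℝ} (hc : ∀ i, 0 < c i)
    (f : SchwartzMap (EuclideanSpace ℝ (Fin N)) ℂ) (k : ℕ) :
    Summable fun n => ‖f (latticePoint c n)‖ * (1 + ‖latticePoint c n‖) ^ k := by
  obtain ⟨C, hC, h⟩ := f.exists_one_add_norm_pow_mul_le (k + 2 * N)
  refine .of_nonneg_of_le (fun n => by positivity) (fun n => ?_)
    ((summable_inv_one_add_norm_latticePoint hc).mul_left C)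
  rw [← div_eq_mul_inv, le_div_iff₀ (by positivity)]
  refine le_of_eq_of_le ?_ (h (latticePoint c n))
  ring

/-- The open box `∏ (-1/(2cᵢ), 1/(2cᵢ))`. -/
def openBox (c : Fin N → ℝ) : Set (EuclideanSpace ℝ (Fin N)) :=
  {w | ∀ i, |w i| < 1 / (2 * c i)}

theorem isOpen_openBox (c : Fin N → ℝ) : IsOpen (openBox c) := by
  simp only [openBox, Set.ofPred_forall]
  exact isOpen_iInter_of_finite fun i => isOpen_lt (by fun_prop) continuous_const

theorem isBounded_openBox (c : Fin N → ℝ) : Bornology.IsBounded (openBox c) := by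
  refine isBounded_iff_forall_norm_le.2 ⟨√(∑ i, (1 / (2 * c i)) ^ 2), fun w hw => ?_⟩
  rw [EuclideanSpace.norm_eq]
  gcongr with i
  exact (hw i).le

theorem mem_openBox_iff {c : Fin N → ℝ} (hc : ∀ i, 0 < c i) {w : EuclideanSpace ℝ (Fin N)} :
    w ∈ openBox c ↔ ∀ i, c i * w i ∈ Set.Ioo (-1 / 2 : ℝ) (1 / 2) := by
  refine forall_congr' fun i => ?_
  have := hc i
  rw [lt_div_iff₀ (by positivity), ← abs_of_pos (show 0 < 2 * c i by positivity), ← abs_mul,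
    abs_lt, Set.mem_Ioo]
  constructor <;> rintro ⟨h₁, h₂⟩ <;> constructor <;> linarith

theorem exists_integral_comp_toLp_div {c : Fin N → ℝ} (hc : ∀ i, 0 < c i) :
    ∃ v : ℝ, 0 < v ∧ ∀ H : EuclideanSpace ℝ (Fin N) → ℂ,
      ∫ x : Fin N → ℝ, H (WithLp.toLp 2 fun i => x i / c i) = v * ∫ w, H w := by
  let L : (Fin N → ℝ) ≃L[ℝ] EuclideanSpace ℝ (Fin N) :=
    (ContinuousLinearEquiv.piCongrRight fun i =>
      ContinuousLinearEquiv.smulLeft (Units.mk0 (c i)⁻¹ (inv_ne_zero (hc i).ne'))).trans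
      (EuclideanSpace.equiv (Fin N) ℝ).symm
  have hL (x : Fin N → ℝ) : L x = WithLp.toLp 2 fun i => x i / c i := by
    ext i
    simp only [L, div_eq_inv_mul]
    rfl
  obtain ⟨v, hv, hcov, -⟩ := L.exists_integral_comp_eq
  exact ⟨v, hv, fun H => by simpa only [hL] using hcov H⟩

/-- The function on the unit torus obtained by periodizing a function supported in `openBox c`. -/
def torusLift (c : Fin N → ℝ) (F : EuclideanSpace ℝ (Fin N) → ℂ) (t : UnitAddTorus (Fin N)) : ℂ :=
  F (WithLp.toLp 2 fun i => (AddCircle.equivIoc 1 (-1 / 2 : ℝ) (t i) : ℝ) / c i)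

theorem torusLift_coe (c : Fin N → ℝ) (F : EuclideanSpace ℝ (Fin N) → ℂ)
    {x : Fin N → ℝ} (hx : ∀ i, x i ∈ Set.Ioc (-1 / 2 : ℝ) (-1 / 2 + 1)) :
    torusLift c F (fun i => (x i : UnitAddCircle)) = F (WithLp.toLp 2 fun i => x i / c i) := by
  simp only [torusLift]
  congr 2
  funext i
  rw [AddCircle.equivIoc_coe_eq (hx i)]

theorem continuous_torusLift {c : Fin N → ℝ} (hc : ∀ i, 0 < c i)
    {F : EuclideanSpace ℝ (Fin N) → ℂ} (hF : Continuous F) (hcpt : HasCompactSupport F)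
    (hsupp : tsupport F ⊆ openBox c) : Continuous (torusLift c F) := by
  let q (w : EuclideanSpace ℝ (Fin N)) : UnitAddTorus (Fin N) := fun i => (c i * w i : ℝ)
  have hq : Continuous q := continuous_pi fun i =>
    (AddCircle.continuous_mk' 1).comp (by fun_prop)
  have hclosed : IsClosed (q '' tsupport F) := (hcpt.isCompact.image hq).isClosed
  have hts : tsupport (torusLift c F) ⊆ q '' tsupport F := by
    refine closure_minimal (fun t ht => ⟨_, subset_tsupport F ht, ?_⟩) hclosed
    funext i
    simp only [q, mul_div_cancel₀ _ (hc i).ne', AddCircle.coe_equivIoc]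
  refine continuous_of_tsupport fun t ht => ?_
  obtain ⟨w, hw, rfl⟩ := hts ht
  refine hF.continuousAt.comp ((PiLp.continuous_toLp 2 _).continuousAt.comp
    (continuousAt_pi.2 fun i => ?_))
  refine ContinuousAt.div_const (continuous_subtype_val.continuousAt.comp
    (ContinuousAt.comp (f := fun t : UnitAddTorus (Fin N) => t i)
      (AddCircle.continuousAt_equivIoc 1 (-1 / 2 : ℝ) ?_) (continuous_apply i).continuousAt)) _
  have hwi := (mem_openBox_iff hc).1 (hsupp hw) i
  simp only [q]
  rw [Ne, AddCircle.coe_eq_coe_iff_of_mem_Ico (a := (-1 / 2 : ℝ))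
    ⟨hwi.1.le, by linarith [hwi.2]⟩ ⟨le_rfl, by norm_num⟩]
  exact hwi.1.ne'

theorem mFourier_coe_mul (c : Fin N → ℝ) (n : Fin N → ℤ) (w : EuclideanSpace ℝ (Fin N)) :
    UnitAddTorus.mFourier n (fun i => ((c i * w i : ℝ) : UnitAddCircle)) =
      𝐞 (inner ℝ w (latticePoint c n)) := by
  simp only [UnitAddTorus.mFourier, ContinuousMap.coe_mk, fourier_coe_apply,
    Real.fourierChar_apply, ← Complex.exp_sum, PiLp.inner_apply, latticePoint]
  congr 1
  push_cast
  rw [Finset.mul_sum, Finset.sum_mul]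
  refine Finset.sum_congr rfl fun i _ => ?_
  simp
  ring

/-- A Schwartz function supported in `openBox c` is the sum of its Fourier series there. -/
theorem exists_hasSum_fourier_latticePoint {c : Fin N → ℝ} (hc : ∀ i, 0 < c i) :
    ∃ v : ℝ, 0 < v ∧ ∀ F : SchwartzMap (EuclideanSpace ℝ (Fin N)) ℂ, HasCompactSupport F →
      tsupport F ⊆ openBox c → ∀ w ∈ openBox c,
      HasSum (fun n => 𝓕 F (latticePoint c n) * 𝐞 (inner ℝ w (latticePoint c n)))
        ((v : ℂ)⁻¹ * F w) := by
  obtain ⟨v, hv, hcov⟩ := exists_integral_comp_toLp_div hc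
  refine ⟨v, hv, fun F hcpt hsupp w hw => ?_⟩
  have hv' : (v : ℂ) ≠ 0 := by exact_mod_cast hv.ne'
  let f : C(UnitAddTorus (Fin N), ℂ) :=
    ⟨torusLift c F, continuous_torusLift hc F.continuous hcpt hsupp⟩
  have hcoeff (n : Fin N → ℤ) :
      UnitAddTorus.mFourierCoeff f n = v * 𝓕 F (latticePoint c n) := by
    rw [UnitAddTorus.mFourierCoeff_eq_integral f n fun _ => -1 / 2, SchwartzMap.fourier_coe,
      Real.fourier_eq, ← hcov,
      ← setIntegral_eq_integral_of_forall_compl_eq_zero (μ := volume)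
        (s := {x : Fin N → ℝ | ∀ i, x i ∈ Set.Ioc (-1 / 2 : ℝ) (-1 / 2 + 1)})]
    · refine setIntegral_congr_fun (MeasurableSet.univ_pi' fun _ => measurableSet_Ioc)
        fun x hx => ?_
      have h := mFourier_coe_mul c (-n) (WithLp.toLp 2 fun i => x i / c i)
      have hneg : latticePoint c (-n) = -latticePoint c n := by
        ext i
        simp [latticePoint]
      simp only [mul_div_cancel₀ _ (hc _).ne', hneg, inner_neg_right] at h
      simp only [h, f, ContinuousMap.coe_mk, torusLift_coe c F hx, Circle.smul_def]
    · intro x hx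
      have h0 : F (WithLp.toLp 2 fun i => x i / c i) = 0 := by
        by_contra hne
        refine hx fun i => ?_
        have h := (mem_openBox_iff hc).1 (hsupp (subset_tsupport F hne)) i
        simp only [mul_div_cancel₀ _ (hc _).ne'] at h
        exact ⟨h.1, by linarith [h.2]⟩
      rw [h0, smul_zero]
  have hsum : Summable (UnitAddTorus.mFourierCoeff f) := by
    simp only [funext hcoeff]
    refine Summable.mul_left _ (.of_norm ?_)
    simpa using summable_norm_schwartz_latticePoint hc (𝓕 F) 0
  have hw' := (mem_openBox_iff hc).1 hw
  have h := (UnitAddTorus.hasSum_mFourier_series_apply_of_summable hsum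
    (fun i => ((c i * w i : ℝ) : UnitAddCircle))).mul_left (v : ℂ)⁻¹
  have hfw : f (fun i => ((c i * w i : ℝ) : UnitAddCircle)) = F w := by
    refine (torusLift_coe c F fun i => ⟨(hw' i).1, by linarith [(hw' i).2]⟩).trans ?_
    congr 1
    ext i
    simp [mul_div_cancel_left₀ _ (hc i).ne']
  rw [hfw] at h
  refine h.congr_fun fun n => ?_
  rw [hcoeff, mFourier_coe_mul, smul_eq_mul]
  field_simp

theorem exists_schwartz_mul_eq_one_near {G : EuclideanSpace ℝ (Fin N) → ℂ}
    {U S : Set (EuclideanSpace ℝ (Fin N))} (hG : ContDiff ℝ (⊤ : ℕ∞) G) (hU : IsOpen U)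
    (hbdd : Bornology.IsBounded U) (hS : IsClosed S) (hSU : S ⊆ U) (hne : ∀ w ∈ U, G w ≠ 0) :
    ∃ κ : SchwartzMap (EuclideanSpace ℝ (Fin N)) ℂ, HasCompactSupport κ ∧ tsupport κ ⊆ U ∧
      ∀ᶠ w in 𝓝ˢ S, κ w * G w = 1 := by
  obtain ⟨χ, hχ0, hχ1, -⟩ := exists_contMDiffMap_zero_one_nhds_of_isClosed (n := (⊤ : ℕ∞))
    (modelWithCornersSelf ℝ (EuclideanSpace ℝ (Fin N))) hU.isClosed_compl hS
    (Set.disjoint_compl_left_iff_subset.2 hSU)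
  have hχU : tsupport χ ⊆ U := by
    intro w hw
    by_contra hwU
    exact notMem_tsupport_iff_eventuallyEq.2 (eventually_nhdsSet_iff_forall.1 hχ0 w hwU) hw
  let k : EuclideanSpace ℝ (Fin N) → ℂ := fun w => (χ w : ℂ) * (G w)⁻¹
  have hk : tsupport k ⊆ tsupport χ := by
    refine closure_mono fun w hw h0 => hw ?_
    simp only [k, h0, Complex.ofReal_zero, zero_mul]
  have hkcpt : HasCompactSupport k := by
    refine HasCompactSupport.of_support_subset_isCompact hbdd.isCompact_closure ?_
    exact (subset_tsupport k).trans (hk.trans (hχU.trans subset_closure))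
  have hksmooth : ContDiff ℝ (⊤ : ℕ∞) k := by
    refine contMDiff_iff_contDiff.1 (contMDiff_of_tsupport fun w hw => ContDiffAt.contMDiffAt ?_)
    have hχs : ContDiff ℝ (⊤ : ℕ∞) χ := χ.contMDiff.contDiff
    exact (Complex.ofRealCLM.contDiff.comp hχs).contDiffAt.mul
      (hG.contDiffAt.inv (hne w (hχU (hk hw))))
  refine ⟨hkcpt.toSchwartzMap hksmooth, hkcpt, hk.trans hχU, ?_⟩
  filter_upwards [hχ1, hU.mem_nhdsSet.2 hSU] with w hw hwU
  simp [k, hw, hne w hwU]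

theorem fourier_compSubConstCLM_apply (f : SchwartzMap (EuclideanSpace ℝ (Fin N)) ℂ)
    (u w : EuclideanSpace ℝ (Fin N)) :
    𝓕 (f.compSubConstCLM ℂ u) w = 𝐞 (-inner ℝ u w) * 𝓕 f w := by
  rw [SchwartzMap.fourier_coe, SchwartzMap.fourier_coe, Real.fourier_eq, Real.fourier_eq,
    ← integral_const_mul,
    ← integral_sub_right_eq_self (fun x => (𝐞 (-inner ℝ u w) : ℂ) * 𝐞 (-inner ℝ x w) • f x) u]
  refine integral_congr_ae (.of_forall fun x => ?_)
  simp only [SchwartzMap.compSubConstCLM_apply, Circle.smul_def, smul_eq_mul, ← mul_assoc,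
    ← Circle.coe_mul, ← AddChar.map_add_eq_mul]
  congr 3
  rw [inner_sub_left]
  ring_nf

theorem fourierInv_compSubConstCLM_apply (f : SchwartzMap (EuclideanSpace ℝ (Fin N)) ℂ)
    (u w : EuclideanSpace ℝ (Fin N)) :
    𝓕⁻ (f.compSubConstCLM ℂ u) w = 𝐞 (inner ℝ u w) * 𝓕⁻ f w := by
  have h (g : SchwartzMap (EuclideanSpace ℝ (Fin N)) ℂ) : 𝓕⁻ g w = 𝓕 g (-w) := by
    rw [SchwartzMap.fourierInv_coe, Real.fourierInv_eq_fourier_neg, SchwartzMap.fourier_coe]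
  rw [h, h, fourier_compSubConstCLM_apply, inner_neg_right, neg_neg]

theorem summable_smul_compSubConstCLM_latticePoint {c : Fin N → ℝ} (hc : ∀ i, 0 < c i)
    (Φ r : SchwartzMap (EuclideanSpace ℝ (Fin N)) ℂ) :
    Summable fun n => Φ (latticePoint c n) • r.compSubConstCLM ℂ (latticePoint c n) := by
  refine SchwartzMap.summable_of_summable_seminorm _ fun k l => ?_
  obtain ⟨C, hC, hr⟩ := r.exists_seminorm_compSubConstCLM_le k l
  refine .of_nonneg_of_le (fun n => apply_nonneg _ _) (fun n => ?_)
    ((summable_norm_schwartz_latticePoint hc Φ k).mul_right C)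
  have hsemi (f : SchwartzMap (EuclideanSpace ℝ (Fin N)) ℂ) :
      SchwartzMap.seminorm ℝ k l f = SchwartzMap.seminorm ℂ k l f := by
    rw [SchwartzMap.seminorm_apply, SchwartzMap.seminorm_apply]
  rw [hsemi, map_smul_eq_mul, ← hsemi, mul_assoc]
  gcongr
  exact hr _

/-- A tempered distribution whose Fourier transform is supported in a closed subset of `openBox c`
is determined by its samples against the lattice translates of a Schwartz function whose inverse
Fourier transform has no zero in `openBox c`. -/
theorem exists_reconstruction_kernel {c : Fin N → ℝ} (hc : ∀ i, 0 < c i)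
    (r : SchwartzMap (EuclideanSpace ℝ (Fin N)) ℂ) {S : Set (EuclideanSpace ℝ (Fin N))}
    (hS : IsClosed S) (hSU : S ⊆ openBox c) (hne : ∀ w ∈ openBox c, 𝓕⁻ r w ≠ 0)
    (σ : SchwartzMap (EuclideanSpace ℝ (Fin N)) ℂ →L[ℂ] ℂ)
    (hσ : ∀ ψ : SchwartzMap (EuclideanSpace ℝ (Fin N)) ℂ, Disjoint (tsupport ψ) S → σ (𝓕 ψ) = 0) :
    ∃ K : SchwartzMap (EuclideanSpace ℝ (Fin N)) ℂ,
      ∀ φ : SchwartzMap (EuclideanSpace ℝ (Fin N)) ℂ,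
        HasSum (fun n => σ (r.compSubConstCLM ℂ (latticePoint c n)) *
          ∫ z, K (z - latticePoint c n) * φ z) (σ φ) := by
  obtain ⟨v, hv, hseries⟩ := exists_hasSum_fourier_latticePoint hc
  have hv' : (v : ℂ) ≠ 0 := by exact_mod_cast hv.ne'
  obtain ⟨κ, hκcpt, hκU, hκ⟩ := exists_schwartz_mul_eq_one_near ((𝓕⁻ r).smooth ⊤)
    (isOpen_openBox c) (isBounded_openBox c) hS hSU hne
  refine ⟨𝓕⁻ ((v : ℂ) • κ), fun φ => ?_⟩
  let F : SchwartzMap (EuclideanSpace ℝ (Fin N)) ℂ :=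
    SchwartzMap.pairing (ContinuousLinearMap.mul ℂ ℂ) κ (𝓕⁻ φ)
  have hF (w : EuclideanSpace ℝ (Fin N)) : F w = κ w * 𝓕⁻ φ w := rfl
  have hFsupp : tsupport F ⊆ tsupport κ := tsupport_mul_subset_left
  have hsample (u : EuclideanSpace ℝ (Fin N)) :
      ∫ z, 𝓕⁻ ((v : ℂ) • κ) (z - u) * φ z = ((v : ℂ) • 𝓕 F) u := by
    have h := SchwartzMap.integral_fourier_mul_eq
      ((𝓕⁻ ((v : ℂ) • κ)).compSubConstCLM ℂ u) (𝓕⁻ φ)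
    simp only [FourierTransform.fourier_fourierInv_eq, SchwartzMap.compSubConstCLM_apply,
      fourier_compSubConstCLM_apply] at h
    rw [← h, _root_.smul_apply, SchwartzMap.fourier_coe, Real.fourier_eq, smul_eq_mul,
      ← integral_const_mul]
    refine integral_congr_ae (.of_forall fun w => ?_)
    simp only [hF, _root_.smul_apply, smul_eq_mul, Circle.smul_def, real_inner_comm u w]
    ring
  obtain ⟨T, hT⟩ := summable_smul_compSubConstCLM_latticePoint hc ((v : ℂ) • 𝓕 F) r
  have hTφ (w : EuclideanSpace ℝ (Fin N)) (hw : w ∈ openBox c) :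
      𝓕⁻ T w = κ w * 𝓕⁻ r w * 𝓕⁻ φ w := by
    let δ : SchwartzMap (EuclideanSpace ℝ (Fin N)) ℂ →L[ℂ] ℂ :=
      ((BoundedContinuousFunction.evalCLM ℂ w).comp
        (SchwartzMap.toBoundedContinuousFunctionCLM ℂ _ ℂ)).comp
        (FourierTransform.fourierInvCLM ℂ (SchwartzMap (EuclideanSpace ℝ (Fin N)) ℂ))
    have hδ (f : SchwartzMap (EuclideanSpace ℝ (Fin N)) ℂ) : δ f = 𝓕⁻ f w := rfl
    have h₁ := δ.hasSum hT
    have h₂ := (hseries F (hκcpt.mono' ((subset_tsupport F).trans hFsupp)) (hFsupp.trans hκU)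
      w hw).mul_left (v * 𝓕⁻ r w)
    refine (hδ T).symm.trans ((h₁.unique (h₂.congr_fun fun n => ?_)).trans ?_)
    · rw [map_smul, hδ, fourierInv_compSubConstCLM_apply, real_inner_comm w, _root_.smul_apply,
        smul_eq_mul, smul_eq_mul]
      ring
    · rw [hF]
      field_simp
  have hψ : Disjoint (tsupport ⇑(𝓕⁻ T - 𝓕⁻ φ)) S := by
    refine Set.disjoint_right.2 fun w hw => notMem_tsupport_iff_eventuallyEq.2 ?_
    filter_upwards [eventually_nhdsSet_iff_forall.1 hκ w hw,
      (isOpen_openBox c).mem_nhds (hSU hw)] with x hx hxU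
    simp [hTφ x hxU, hx]
  have hσT : σ T = σ φ := by
    have h := hσ _ hψ
    rwa [← FourierTransform.fourierCLM_apply (R := ℂ), map_sub,
      FourierTransform.fourierCLM_apply, FourierTransform.fourierCLM_apply,
      FourierTransform.fourier_fourierInv_eq,
      FourierTransform.fourier_fourierInv_eq, map_sub, sub_eq_zero] at h
  rw [← hσT]
  refine (σ.hasSum hT).congr_fun fun n => ?_
  rw [hsample, map_smul, smul_eq_mul, mul_comm]

end Lattice

section Gabor

variable {d : ℕ}

theorem zx_apply (z : EuclideanSpace ℝ (Fin (d + d))) (i : Fin d) :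
    zx z i = z (Fin.castAdd d i) := rfl

theorem zxi_apply (z : EuclideanSpace ℝ (Fin (d + d))) (i : Fin d) :
    zxi z i = z (Fin.natAdd d i) := rfl

theorem mk2_castAdd (x ξ : EuclideanSpace ℝ (Fin d)) (i : Fin d) :
    mk2 x ξ (Fin.castAdd d i) = x i := by
  simp [mk2]

theorem mk2_natAdd (x ξ : EuclideanSpace ℝ (Fin d)) (i : Fin d) :
    mk2 x ξ (Fin.natAdd d i) = ξ i := by
  simp [mk2, -Fin.natAdd_eq_addNat]

theorem zx_mk2 (x ξ : EuclideanSpace ℝ (Fin d)) : zx (mk2 x ξ) = x := by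
  ext i
  rw [zx_apply, mk2_castAdd]

theorem zxi_mk2 (x ξ : EuclideanSpace ℝ (Fin d)) : zxi (mk2 x ξ) = ξ := by
  ext i
  rw [zxi_apply, mk2_natAdd]

theorem mk2_zx_zxi (z : EuclideanSpace ℝ (Fin (d + d))) : mk2 (zx z) (zxi z) = z := by
  ext i
  refine Fin.addCases (fun j => ?_) (fun j => ?_) i
  · rw [mk2_castAdd, zx_apply]
  · rw [mk2_natAdd, zxi_apply]

theorem zx_sub (z w : EuclideanSpace ℝ (Fin (d + d))) : zx (z - w) = zx z - zx w := rfl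

theorem zxi_sub (z w : EuclideanSpace ℝ (Fin (d + d))) : zxi (z - w) = zxi z - zxi w := rfl

theorem inner_mk2_left (x ξ : EuclideanSpace ℝ (Fin d)) (w : EuclideanSpace ℝ (Fin (d + d))) :
    inner ℝ (mk2 x ξ) w = inner ℝ x (zx w) + inner ℝ ξ (zxi w) := by
  simp only [PiLp.inner_apply, Fin.sum_univ_add, mk2_castAdd, mk2_natAdd, zx_apply, zxi_apply]

/-- `mk2` as a continuous linear equivalence. -/
def mk2Equiv : (EuclideanSpace ℝ (Fin d) × EuclideanSpace ℝ (Fin d)) ≃L[ℝ]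
    EuclideanSpace ℝ (Fin (d + d)) :=
  LinearEquiv.toContinuousLinearEquiv
    (LinearEquiv.symm
      { toFun := fun z => (zx z, zxi z)
        invFun := fun p => mk2 p.1 p.2
        map_add' := fun _ _ => rfl
        map_smul' := fun _ _ => rfl
        left_inv := mk2_zx_zxi
        right_inv := fun p => by simp only [zx_mk2, zxi_mk2] })

theorem mk2Equiv_apply (p : EuclideanSpace ℝ (Fin d) × EuclideanSpace ℝ (Fin d)) :
    mk2Equiv p = mk2 p.1 p.2 := rfl

/-- The Fourier transform intertwines time-frequency shifts up to a phase factor. -/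
theorem fourier_tf (x₀ ξ₀ : EuclideanSpace ℝ (Fin d)) (g : EuclideanSpace ℝ (Fin d) → ℂ)
    (ξ : EuclideanSpace ℝ (Fin d)) :
    𝓕 (tf x₀ ξ₀ g) ξ =
      cexp (-(2 * π * I) * (inner ℝ x₀ (ξ - ξ₀) : ℝ)) * 𝓕 g (ξ - ξ₀) := by
  rw [Real.fourier_eq', Real.fourier_eq', ← integral_const_mul]
  symm
  rw [← integral_sub_right_eq_self _ x₀]
  refine integral_congr_ae (Eventually.of_forall fun t => ?_)
  simp only [tf, smul_eq_mul, ← mul_assoc, ← Complex.exp_add]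
  congr 2
  simp only [inner_sub_left, inner_sub_right, real_inner_comm ξ₀]
  push_cast
  ring

/-- Covariance of the Rihaczek distribution under time-frequency shifts. -/
theorem rihaczek_tf (x₀ ξ₀ : EuclideanSpace ℝ (Fin d)) (g : EuclideanSpace ℝ (Fin d) → ℂ)
    (z : EuclideanSpace ℝ (Fin (d + d))) :
    rihaczek (tf x₀ ξ₀ g) (tf x₀ ξ₀ g) z = rihaczek g g (z - mk2 x₀ ξ₀) := by
  simp only [rihaczek, fourier_tf, tf, zx_sub, zxi_sub, zx_mk2, zxi_mk2, map_mul,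
    ← Complex.exp_conj, map_neg, conj_I, conj_ofReal, map_ofNat]
  have h : cexp (-(2 * π * I) * (inner ℝ (zx z - x₀) (zxi z - ξ₀) : ℝ)) =
      cexp (2 * π * I * (inner ℝ ξ₀ (zx z) : ℝ)) *
      cexp (-(2 * π * -I) * (inner ℝ x₀ (zxi z - ξ₀) : ℝ)) *
      cexp (-(2 * π * I) * (inner ℝ (zx z) (zxi z) : ℝ)) := by
    rw [← Complex.exp_add, ← Complex.exp_add]
    congr 1
    simp only [inner_sub_left, inner_sub_right, real_inner_comm ξ₀]
    push_cast
    ring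
  rw [h]
  ring

theorem tf_zero_zero (g : EuclideanSpace ℝ (Fin d) → ℂ) : tf 0 0 g = g := by
  funext t
  simp [tf]

/-- The inverse Fourier transform of the conjugate Rihaczek distribution of `g` is, up to a
positive constant, the conjugate of `UVgg g`. -/
theorem fourierInv_conj_rihaczek (g : SchwartzMap (EuclideanSpace ℝ (Fin d)) ℂ)
    (r : SchwartzMap (EuclideanSpace ℝ (Fin (d + d))) ℂ)
    (hr : ∀ z, r z = (starRingEnd ℂ) (rihaczek g g z)) :
    ∃ v : ℝ, ∀ w, (starRingEnd ℂ) (UVgg g w) = v * 𝓕⁻ r w := by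
  have : (volume : Measure (EuclideanSpace ℝ (Fin d) ×
      EuclideanSpace ℝ (Fin d))).IsAddHaarMeasure :=
    Measure.prod.instIsAddHaarMeasure _ _
  obtain ⟨v, -, hv, hcov⟩ := ContinuousLinearEquiv.exists_integral_comp_eq (mk2Equiv (d := d))
  refine ⟨v, fun w => ?_⟩
  rw [SchwartzMap.fourierInv_coe, Real.fourierInv_eq', ← hv]
  have hi : Integrable fun z => cexp (↑(2 * π * inner ℝ z w) * I) • r z := by
    refine r.integrable.bdd_mul (c := 1) ?_ (Eventually.of_forall fun z => ?_)
    · exact Continuous.aestronglyMeasurable (by fun_prop)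
    · rw [Complex.norm_exp_ofReal_mul_I]
  have hi := hcov _ hi
  rw [Measure.volume_eq_prod] at hi ⊢
  rw [integral_prod _ hi, UVgg, stft, ← integral_conj]
  refine integral_congr_ae (Eventually.of_forall fun x => ?_)
  have hg : g (x + zxi w) = ∫ ξ, cexp (↑(2 * π * inner ℝ ξ (x + zxi w)) * I) • 𝓕 (⇑g) ξ := by
    rw [← Real.fourierInv_eq', ← SchwartzMap.fourier_coe, ← SchwartzMap.fourierInv_coe,
      FourierTransform.fourierInv_fourier_eq]
  simp only [map_mul, sub_neg_eq_add, Complex.conj_conj]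
  rw [hg, mul_right_comm, ← integral_const_mul]
  refine integral_congr_ae (Eventually.of_forall fun ξ => ?_)
  simp only [mk2Equiv_apply, hr, rihaczek, zx_mk2, zxi_mk2, inner_mk2_left, map_mul,
    Complex.conj_conj, smul_eq_mul, ← Complex.exp_conj, map_neg, conj_I, conj_ofReal, map_ofNat]
  have h : cexp (-(2 * π * -I) * (inner ℝ (zx w) x : ℝ)) *
      cexp (↑(2 * π * inner ℝ ξ (x + zxi w)) * I) =
      cexp (↑(2 * π * (inner ℝ x (zx w) + inner ℝ ξ (zxi w))) * I) *
      cexp (-(2 * π * -I) * (inner ℝ x ξ : ℝ)) := by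
    rw [← Complex.exp_add, ← Complex.exp_add]
    congr 1
    simp only [inner_add_right, real_inner_comm x]
    push_cast
    ring
  linear_combination (starRingEnd ℂ) (g x) * 𝓕 (⇑g) ξ * h

/-- The step sizes of the lattice `aℤ^d × bℤ^d`. -/
def gaborSteps (d : ℕ) (a b : ℝ) : Fin (d + d) → ℝ :=
  Fin.append (fun _ => a) fun _ => b

theorem latticePoint_gaborSteps (a b : ℝ) (kl : (Fin d → ℤ) × (Fin d → ℤ)) :
    latticePoint (gaborSteps d a b) (Fin.appendEquiv d d kl) = lat a b kl := by
  ext i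
  refine Fin.addCases (fun j => ?_) (fun j => ?_) i
  · simp [latticePoint, gaborSteps, lat, mk2_castAdd, vecd, Fin.appendEquiv]
  · simp [latticePoint, gaborSteps, lat, mk2_natAdd, vecd, Fin.appendEquiv, -Fin.natAdd_eq_addNat]

theorem mem_openBox_gaborSteps {a b : ℝ} {w : EuclideanSpace ℝ (Fin (d + d))} :
    w ∈ openBox (gaborSteps d a b) ↔
      (∀ i, |zx w i| < 1 / (2 * a)) ∧ ∀ i, |zxi w i| < 1 / (2 * b) := by
  simp [openBox, gaborSteps, Fin.forall_fin_add, zx_apply, zxi_apply, -Fin.natAdd_eq_addNat]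

theorem isClosed_Qbox (a b ε : ℝ) : IsClosed (Qbox (d := d) a b ε) := by
  have h : Qbox (d := d) a b ε =
      (⋂ i : Fin d, {z | |z (Fin.castAdd d i)| ≤ 1 / (2 * a) - ε}) ∩
        ⋂ i : Fin d, {z | |z (Fin.natAdd d i)| ≤ 1 / (2 * b) - ε} := by
    ext z
    simp [Qbox, zx_apply, zxi_apply]
  rw [h]
  exact (isClosed_iInter fun i => isClosed_le (by fun_prop) continuous_const).inter
    (isClosed_iInter fun i => isClosed_le (by fun_prop) continuous_const)

end Gabor

/-- reconstruction of a tempered distribution σ on ℝ^{2d} whose Fourier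
transform is supported in Q_ε from the diagonal H_{λλ} = ⟨σ, R(π(λ)g, π(λ)g)⟩ of its
channel matrix with respect to the Gabor system over Λ = aℤ^d × bℤ^d: there is a kernel
K ∈ 𝒮(ℝ^{2d}) with σ = Σ_λ H_{λλ} T_λ K, converging in 𝒮′(ℝ^{2d}).  The Schwartz
function `Rbar kl` is the conjugate of R(π(λ)g, π(λ)g) for λ = (a·kl.1, b·kl.2), so that
σ (Rbar kl) = ⟨σ, R(π(λ)g, π(λ)g)⟩ = H_{λλ}. -/
theorem statement_0 {d : ℕ} (hd : 1 ≤ d) (a b : ℝ) (ha : 0 < a) (hb : 0 < b)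
    (g : SchwartzMap (EuclideanSpace ℝ (Fin d)) ℂ)
    (hnv : ∀ z ∈ Qbox a b (0 : ℝ), UVgg (⇑g) z ≠ 0)
    (σ : SchwartzMap (EuclideanSpace ℝ (Fin (d + d))) ℂ →L[ℂ] ℂ)
    (ε : ℝ) (hε : 0 < ε)
    (hσhat : ∀ ψ : SchwartzMap (EuclideanSpace ℝ (Fin (d + d))) ℂ,
      Disjoint (tsupport ⇑ψ) (Qbox a b ε) → σ (SchwartzMap.fourierTransformCLM ℂ ψ) = 0)
    (Rbar : (Fin d → ℤ) × (Fin d → ℤ) → SchwartzMap (EuclideanSpace ℝ (Fin (d + d))) ℂ)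
    (hRbar : ∀ kl z, Rbar kl z = (starRingEnd ℂ)
      (rihaczek (tf (vecd a kl.1) (vecd b kl.2) (⇑g)) (tf (vecd a kl.1) (vecd b kl.2) (⇑g)) z)) :
    ∃ K : SchwartzMap (EuclideanSpace ℝ (Fin (d + d))) ℂ,
      ∀ φ : SchwartzMap (EuclideanSpace ℝ (Fin (d + d))) ℂ,
        HasSum (fun kl => σ (Rbar kl) * ∫ z, K (z - lat a b kl) * φ z) (σ φ) := by
  have hr0 : ∀ z, Rbar 0 z = (starRingEnd ℂ) (rihaczek g g z) := fun z => by
    have h0 (c : ℝ) : vecd (d := d) c 0 = 0 := by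
      ext i
      simp [vecd]
    rw [hRbar, Prod.fst_zero, Prod.snd_zero, h0, h0, tf_zero_zero]
  have hR (kl) : Rbar kl = (Rbar 0).compSubConstCLM ℂ (lat a b kl) := by
    ext z
    rw [SchwartzMap.compSubConstCLM_apply, hr0, hRbar, rihaczek_tf, lat]
  obtain ⟨v, hv⟩ := fourierInv_conj_rihaczek g (Rbar 0) hr0
  have hc : ∀ i, 0 < gaborSteps d a b i := by
    simp [gaborSteps, Fin.forall_fin_add, ha, hb, -Fin.natAdd_eq_addNat]
  obtain ⟨K, hK⟩ := exists_reconstruction_kernel hc (Rbar 0) (isClosed_Qbox a b ε)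
    (fun w hw => mem_openBox_gaborSteps.2
      ⟨fun i => (hw.1 i).trans_lt (sub_lt_self _ hε),
        fun i => (hw.2 i).trans_lt (sub_lt_self _ hε)⟩)
    (fun w hw h0 => by
      obtain ⟨h₁, h₂⟩ := mem_openBox_gaborSteps.1 hw
      refine hnv w ⟨fun i => by simpa using (h₁ i).le, fun i => by simpa using (h₂ i).le⟩ ?_
      simpa [h0] using hv w)
    σ hσhat
  refine ⟨K, fun φ => ?_⟩
  simpa only [Function.comp_def, latticePoint_gaborSteps, ← hR] using
    (Fin.appendEquiv d d).hasSum_iff.2 (hK φ)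
end
end

section
/- Let σ ∈ 𝒮′(ℝ²) be a tempered distribution whose distributional Fourier transform σ̂ is compactly supported (i.e. there is a compact set S ⊆ ℝ² such that σ̂ annihilates every Schwartz function whose support is disjoint from S), let φ(x) = e^{−πx²} be the Gaussian, and let Λ = aℤ × bℤ be an arbitrary lattice (a, b > 0). If the full channel matrix vanishes, i.e. H_{λμ} = ⟨σ^{KN} π(μ)φ, π(λ)φ⟩ = ⟨σ, R(π(λ)φ, π(μ)φ)⟩ = 0 for all λ, μ ∈ Λ, then σ = 0 (equivalently, the operator σ^{KN} is identically zero). -/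
noncomputable section

open MeasureTheory Complex Filter Real
open scoped FourierTransform Convolution Topology ENNReal

/-- the Gaussian φ(x) = e^{−πx²} on ℝ (as a function on the 1-dimensional Euclidean space) -/
def gauss : EuclideanSpace ℝ (Fin 1) → ℂ :=
  fun t => ((Real.exp (-Real.pi * (t 0) ^ 2) : ℝ) : ℂ)

/-- A Schwarz-type estimate: an entire function vanishing on a finite subset `T` of the disc of
radius `r` and bounded by `M` on the circle of radius `R` is small inside when `T` is large. -/
theorem norm_le_of_zeros (T : Finset ℂ) : ∀ (f : ℂ → ℂ) (r R M : ℝ),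
    Differentiable ℂ f → r < R →
    (∀ c ∈ T, ‖c‖ ≤ r) → (∀ c ∈ T, f c = 0) → (∀ z, ‖z‖ = R → ‖f z‖ ≤ M) →
    0 < R → ∀ z, ‖z‖ ≤ R → ‖f z‖ ≤ M * ((‖z‖ + r) / (R - r)) ^ T.card := by
  classical
  induction T using Finset.induction_on with
  | empty =>
    intro f r R M hf hrR _ _ hM hR z hz
    simp only [Finset.card_empty, pow_zero, mul_one]
    refine Complex.norm_le_of_forall_mem_frontier_norm_le (U := Metric.ball 0 R)
      Metric.isBounded_ball hf.diffContOnCl ?_ ?_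
    · intro z hz
      rw [frontier_ball _ hR.ne'] at hz
      exact hM z (by simpa using hz)
    · rw [closure_ball _ hR.ne']; simpa using hz
  | insert c T hc ih =>
    intro f r R M hf hrR hT h0 hM hR z hz
    have hfc : f c = 0 := h0 c (by simp)
    have hcr : ‖c‖ ≤ r := hT c (by simp)
    have key : ∀ z, f z = (z - c) * dslope f c z := by
      intro z
      have := sub_smul_dslope f c z
      rw [hfc, sub_zero, smul_eq_mul] at this
      exact this.symm
    have hd : Differentiable ℂ (dslope f c) := by
      rw [← differentiableOn_univ]
      exact (Complex.differentiableOn_dslope (by simp)).2 hf.differentiableOn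
    have hr : 0 < R - r := by linarith
    have := ih (dslope f c) r R (M / (R - r)) hd hrR (fun a ha => hT a (by simp [ha])) ?_ ?_ hR z hz
    · rw [key z, norm_mul, Finset.card_insert_of_notMem hc, pow_succ]
      have h1 : ‖z - c‖ ≤ ‖z‖ + r := (norm_sub_le _ _).trans (by gcongr)
      have h2 : 0 ≤ ‖z‖ + r := (norm_nonneg _).trans h1
      calc _ ≤ (‖z‖ + r) * (M / (R - r) * ((‖z‖ + r) / (R - r)) ^ T.card) := by gcongr
        _ = _ := by ring
    · intro a ha
      have hne : a ≠ c := fun h => hc (h ▸ ha)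
      have := key a
      rw [h0 a (by simp [ha])] at this
      exact (mul_eq_zero.1 this.symm).resolve_left (sub_ne_zero.2 hne)
    · intro w hw
      rw [le_div_iff₀ hr]
      have h2 := hM w hw
      rw [key w, norm_mul] at h2
      have h1 : R - r ≤ ‖w - c‖ := by
        have := norm_sub_norm_le w c
        linarith
      have h3 : (R - r) * ‖dslope f c w‖ ≤ ‖w - c‖ * ‖dslope f c w‖ := by gcongr
      linarith

/-- An entire function of exponential type vanishing on the lattice `aℤ + i bℤ` is zero, as its
zeros are too dense. -/
theorem eq_zero_of_exponential_type_of_lattice {f : ℂ → ℂ} (hf : Differentiable ℂ f) {C K : ℝ}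
    (hbound : ∀ z, ‖f z‖ ≤ C * Real.exp (K * ‖z‖)) {a b : ℝ} (ha : 0 < a) (hb : 0 < b)
    (h0 : ∀ k l : ℤ, f (a * k - I * (b * l)) = 0) (z : ℂ) : f z = 0 := by
  set p : ℕ × ℕ → ℂ := fun kl => a * (kl.1 : ℤ) - I * (b * (kl.2 : ℤ)) with hp
  have hinj : Function.Injective p := by
    rintro ⟨k, l⟩ ⟨k', l'⟩ h
    have h1 := congrArg re h
    have h2 := congrArg im h
    simp [hp, ha.ne', hb.ne'] at h1 h2
    simp [h1, h2]
  have hs : 0 < a + b := by positivity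
  have main : ∀ n : ℕ, 2 * ‖z‖ ≤ (a + b) * n → 0 < n →
      ‖f z‖ ≤ C * Real.exp (K * (3 * ((a + b) * n))) * (3 / 4) ^ (n * n) := by
    intro n hn hn0
    have hn0' : (0 : ℝ) < n := by exact_mod_cast hn0
    have hpos : 0 < (a + b) * n := by positivity
    have := norm_le_of_zeros ((Finset.range n ×ˢ Finset.range n).image p) f ((a + b) * n)
      (3 * ((a + b) * n)) (C * Real.exp (K * (3 * ((a + b) * n)))) hf (by linarith) ?_ ?_ ?_
      (by linarith) z (by linarith [norm_nonneg z])
    · rw [Finset.card_image_of_injective _ hinj] at this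
      simp only [Finset.card_product, Finset.card_range] at this
      refine this.trans ?_
      have hC : 0 ≤ C := by
        have := (norm_nonneg _).trans (hbound 0)
        simpa using this
      have h1 : 0 < 3 * ((a + b) * n) - (a + b) * n := by linarith
      have h2 : (‖z‖ + (a + b) * n) / (3 * ((a + b) * n) - (a + b) * n) ≤ 3 / 4 := by
        rw [div_le_iff₀ h1]
        linarith
      gcongr
    · intro c hc
      simp only [Finset.mem_image, Finset.mem_product, Finset.mem_range, Prod.exists] at hc
      obtain ⟨k, l, ⟨hk, hl⟩, rfl⟩ := hc
      have hk' : (k : ℝ) ≤ n := by exact_mod_cast hk.le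
      have hl' : (l : ℝ) ≤ n := by exact_mod_cast hl.le
      calc ‖p (k, l)‖ ≤ a * k + b * l := by
            refine (norm_sub_le _ _).trans ?_
            simp [abs_of_pos, ha, hb]
        _ ≤ a * n + b * n := by gcongr
        _ = _ := by ring
    · intro c hc
      simp only [Finset.mem_image, Finset.mem_product, Finset.mem_range, Prod.exists] at hc
      obtain ⟨k, l, -, rfl⟩ := hc
      exact h0 k l
    · intro w hw
      rw [← hw]
      exact hbound w
  have hlim : Tendsto (fun n : ℕ => C * Real.exp (K * (3 * ((a + b) * n))) * (3 / 4 : ℝ) ^ (n * n))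
      atTop (𝓝 0) := by
    have e : (fun n : ℕ => C * Real.exp (K * (3 * ((a + b) * n))) * (3 / 4 : ℝ) ^ (n * n)) =
        fun n : ℕ => C * Real.exp (n * (K * (3 * (a + b)) + n * Real.log (3 / 4))) := by
      funext n
      rw [mul_add, Real.exp_add, mul_assoc]
      congr 2
      · ring_nf
      · rw [← Real.exp_log (show (0 : ℝ) < 3 / 4 by norm_num), ← Real.exp_nat_mul,
          Real.exp_log (show (0 : ℝ) < 3 / 4 by norm_num)]
        push_cast
        ring_nf
    rw [e, ← mul_zero C]
    refine Tendsto.const_mul _ (Real.tendsto_exp_atBot.comp ?_)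
    have hl : Real.log (3 / 4) < 0 := Real.log_neg (by norm_num) (by norm_num)
    exact tendsto_natCast_atTop_atTop.atTop_mul_atBot₀ (tendsto_atBot_add_const_left _ _
      (tendsto_natCast_atTop_atTop.atTop_mul_const_of_neg hl))
  have hev : ∀ᶠ n : ℕ in atTop, ‖f z‖ ≤
      C * Real.exp (K * (3 * ((a + b) * n))) * (3 / 4 : ℝ) ^ (n * n) := by
    have h1 : Tendsto (fun n : ℕ => (a + b) * (n : ℝ)) atTop atTop :=
      tendsto_natCast_atTop_atTop.const_mul_atTop hs
    filter_upwards [h1.eventually_ge_atTop (2 * ‖z‖), eventually_gt_atTop 0] with n h1 h2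
    exact main n h1 h2
  exact norm_le_zero_iff.1 (ge_of_tendsto hlim hev)

open scoped SchwartzMap ContDiff

namespace SchwartzMap
variable {E : Type*} [NormedAddCommGroup E] [NormedSpace ℝ E]

/-- A series of Schwartz functions whose seminorms are summable converges in the Schwartz space to
its pointwise sum. -/
theorem hasSum_of_summable_seminorm {ι : Type*} {F : ι → 𝓢(E, ℂ)} {G : 𝓢(E, ℂ)}
    (hF : ∀ k n, Summable fun i => SchwartzMap.seminorm ℂ k n (F i))
    (hG : ∀ x, HasSum (fun i => F i x) (G x)) : HasSum F G := by
  have hder : ∀ n x, iteratedFDeriv ℝ n G x = ∑' i, iteratedFDeriv ℝ n (F i) x := by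
    intro n x
    have : (G : E → ℂ) = fun y => ∑' i, F i y := funext fun y => (hG y).tsum_eq.symm
    rw [this]
    exact iteratedFDeriv_tsum_apply (𝕜 := ℝ) (N := ⊤) (f := fun i y => F i y)
      (v := fun n i => SchwartzMap.seminorm ℂ 0 n (F i))
      (fun i => (F i).smooth _) (fun k _ => hF 0 k)
      (fun k i x _ => norm_iteratedFDeriv_le_seminorm ℂ (F i) k x) le_top x
  have hsum : ∀ n x, Summable fun i => iteratedFDeriv ℝ n (F i) x := fun n x =>
    Summable.of_norm_bounded (hF 0 n) fun i => norm_iteratedFDeriv_le_seminorm ℂ (F i) n x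
  rw [HasSum, SummationFilter.unconditional_filter,
    (schwartz_withSeminorms ℂ E ℂ).tendsto_nhds]
  rintro ⟨k, n⟩ ε hε
  have htail := (tendsto_tsum_compl_atTop_zero fun i => SchwartzMap.seminorm ℂ k n (F i))
  filter_upwards [htail.eventually_lt_const hε] with s hs
  refine lt_of_le_of_lt ?_ hs
  rw [schwartzSeminormFamily_apply]
  refine seminorm_le_bound ℂ k n _ (tsum_nonneg fun i => apply_nonneg _ _) fun x => ?_
  have h1 : iteratedFDeriv ℝ n (⇑(∑ i ∈ s, F i - G)) x =
      - ∑' i : {i // i ∉ s}, iteratedFDeriv ℝ n (F i) x := by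
    have e : (⇑(∑ i ∈ s, F i - G) : E → ℂ) = (fun y => ∑ i ∈ s, F i y) - ⇑G := by
      ext y
      simp
    rw [e, iteratedFDeriv_sub_apply, iteratedFDeriv_fun_sum_apply, hder]
    · rw [← (hsum n x).sum_add_tsum_subtype_compl s]
      abel_nf
    · exact fun i _ => ((F i).smooth n).contDiffAt
    · exact (ContDiff.sum fun i _ => (F i).smooth n).contDiffAt
    · exact (G.smooth n).contDiffAt
  rw [h1, norm_neg]
  have h2 : Summable fun i : {i // i ∉ s} => ‖iteratedFDeriv ℝ n (F i) x‖ :=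
    ((hF 0 n).subtype _).of_nonneg_of_le (fun _ => norm_nonneg _) fun i =>
      norm_iteratedFDeriv_le_seminorm ℂ (F i) n x
  calc ‖x‖ ^ k * ‖∑' i : {i // i ∉ s}, iteratedFDeriv ℝ n (F i) x‖
      ≤ ‖x‖ ^ k * ∑' i : {i // i ∉ s}, ‖iteratedFDeriv ℝ n (F i) x‖ := by
        gcongr
        exact norm_tsum_le_tsum_norm h2
    _ = ∑' i : {i // i ∉ s}, ‖x‖ ^ k * ‖iteratedFDeriv ℝ n (F i) x‖ := tsum_mul_left.symm
    _ ≤ _ := Summable.tsum_le_tsum (fun i => le_seminorm ℂ k n (F i) x) (h2.mul_left _)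
        ((hF k n).subtype _)

theorem seminorm_mul_le_of_bound {u : E → ℂ} (hu : ContDiff ℝ ∞ u) (g f : 𝓢(E, ℂ))
    (hf : ∀ x, f x = u x * g x) (k n : ℕ) {M N : ℝ} (hN : 0 ≤ N)
    (hM : ∀ i ≤ n, ∀ x, ‖iteratedFDeriv ℝ i u x‖ ≤ M)
    (hg : ∀ i ≤ n, SchwartzMap.seminorm ℂ k i g ≤ N) :
    ∀ i ≤ n, SchwartzMap.seminorm ℂ k i f ≤ 2 ^ n * M * N := by
  have hM0 : 0 ≤ M := (norm_nonneg _).trans (hM 0 (Nat.zero_le _) 0)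
  intro i hi
  refine seminorm_le_bound ℂ k i f (by positivity) fun x => ?_
  have e : (f : E → ℂ) = fun y => u y * g y := funext hf
  rw [e]
  calc ‖x‖ ^ k * ‖iteratedFDeriv ℝ i (fun y => u y * g y) x‖
      ≤ ‖x‖ ^ k * ∑ j ∈ Finset.range (i + 1), (i.choose j : ℝ) * ‖iteratedFDeriv ℝ j u x‖ *
          ‖iteratedFDeriv ℝ (i - j) g x‖ := by
        gcongr
        exact norm_iteratedFDeriv_mul_le hu (g.smooth ⊤) x (by exact_mod_cast le_top)
    _ = ∑ j ∈ Finset.range (i + 1), (i.choose j : ℝ) * ‖iteratedFDeriv ℝ j u x‖ *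
          (‖x‖ ^ k * ‖iteratedFDeriv ℝ (i - j) g x‖) := by
        rw [Finset.mul_sum]
        exact Finset.sum_congr rfl fun _ _ => by ring
    _ ≤ ∑ j ∈ Finset.range (i + 1), (i.choose j : ℝ) * M * N := by
        refine Finset.sum_le_sum fun j hj => ?_
        have hj' : j ≤ i := Nat.lt_succ_iff.1 (Finset.mem_range.1 hj)
        gcongr
        · exact hM j (hj'.trans hi) x
        · exact (le_seminorm ℂ k (i - j) g x).trans (hg _ ((Nat.sub_le _ _).trans hi))
    _ = 2 ^ i * M * N := by
        rw [← Finset.sum_mul, ← Finset.sum_mul]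
        congr 2
        exact_mod_cast Nat.sum_range_choose i
    _ ≤ 2 ^ n * M * N := by
        gcongr
        norm_num

theorem exists_seminorm_pow_mul_le (h g : 𝓢(E, ℂ)) (k n : ℕ) :
    ∃ C K : ℝ, 0 ≤ C ∧ 0 ≤ K ∧ ∀ m : ℕ, SchwartzMap.seminorm ℂ k n
      ((smulLeftCLM ℂ h)^[m] g) ≤ C * K ^ m := by
  obtain ⟨M, hM⟩ : ∃ M : ℝ, ∀ i ≤ n, SchwartzMap.seminorm ℂ 0 i h ≤ M :=
    ⟨∑ i ∈ Finset.range (n + 1), SchwartzMap.seminorm ℂ 0 i h, fun i hi =>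
      Finset.single_le_sum (f := fun i => SchwartzMap.seminorm ℂ 0 i h)
        (fun _ _ => apply_nonneg _ _) (Finset.mem_range.2 (Nat.lt_succ_of_le hi))⟩
  obtain ⟨N, hN⟩ : ∃ N : ℝ, ∀ i ≤ n, SchwartzMap.seminorm ℂ k i g ≤ N :=
    ⟨∑ i ∈ Finset.range (n + 1), SchwartzMap.seminorm ℂ k i g, fun i hi =>
      Finset.single_le_sum (f := fun i => SchwartzMap.seminorm ℂ k i g)
        (fun _ _ => apply_nonneg _ _) (Finset.mem_range.2 (Nat.lt_succ_of_le hi))⟩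
  have hM0 : 0 ≤ M := (apply_nonneg _ _).trans (hM 0 (Nat.zero_le _))
  have hN0 : 0 ≤ N := (apply_nonneg _ _).trans (hN 0 (Nat.zero_le _))
  refine ⟨N, 2 ^ n * M, hN0, by positivity, fun m => ?_⟩
  suffices ∀ i ≤ n, SchwartzMap.seminorm ℂ k i ((smulLeftCLM ℂ h)^[m] g) ≤
      N * (2 ^ n * M) ^ m from this n le_rfl
  induction m with
  | zero => simpa using hN
  | succ m ih =>
    rw [Function.iterate_succ_apply']
    have := seminorm_mul_le_of_bound (h.smooth ⊤) _ (smulLeftCLM ℂ h ((smulLeftCLM ℂ h)^[m] g))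
      (fun x => by rw [smulLeftCLM_apply_apply h.hasTemperateGrowth, smul_eq_mul]) k n
      (by positivity) (fun i hi x => (norm_iteratedFDeriv_le_seminorm ℂ h i x).trans (hM i hi)) ih
    intro i hi
    refine (this i hi).trans_eq ?_
    ring

theorem smulLeftCLM_iterate_apply (h g : 𝓢(E, ℂ)) (m : ℕ) (x : E) :
    (smulLeftCLM ℂ h)^[m] g x = h x ^ m * g x := by
  induction m with
  | zero => simp
  | succ m ih =>
    rw [Function.iterate_succ_apply', smulLeftCLM_apply_apply h.hasTemperateGrowth, ih,
      smul_eq_mul, pow_succ]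
    ring

theorem hasSum_exp_mul (h g : 𝓢(E, ℂ)) (t : ℂ) {G : 𝓢(E, ℂ)}
    (hG : ∀ x, G x = Complex.exp (t * h x) * g x) :
    HasSum (fun m : ℕ => (t ^ m / (m.factorial : ℂ)) • (smulLeftCLM ℂ h)^[m] g) G := by
  refine hasSum_of_summable_seminorm (fun k n => ?_) fun x => ?_
  · obtain ⟨C, K, hC, hK, hCK⟩ := exists_seminorm_pow_mul_le h g k n
    refine Summable.of_nonneg_of_le (fun _ => apply_nonneg _ _) (fun m => ?_)
      ((Real.summable_pow_div_factorial (‖t‖ * K)).mul_left C)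
    rw [map_smul_eq_mul, norm_div, norm_pow, Complex.norm_natCast, mul_pow]
    calc _ ≤ ‖t‖ ^ m / (m.factorial : ℝ) * (C * K ^ m) := by gcongr; exact hCK m
      _ = _ := by ring
  · rw [hG x]
    have := (NormedSpace.expSeries_div_hasSum_exp (t * h x)).mul_right (g x)
    rw [← Complex.exp_eq_exp_ℂ] at this
    refine this.congr_fun ?_
    intro m
    simp only [smul_apply, smul_eq_mul, smulLeftCLM_iterate_apply]
    ring

theorem exists_norm_pow_le (T : 𝓢(E, ℂ) →L[ℂ] ℂ) (h g : 𝓢(E, ℂ)) :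
    ∃ C K : ℝ, 0 ≤ C ∧ 0 ≤ K ∧ ∀ m : ℕ, ‖T ((smulLeftCLM ℂ h)^[m] g)‖ ≤ C * K ^ m := by
  obtain ⟨s, B, -, hB⟩ := Seminorm.bound_of_continuous (schwartz_withSeminorms ℂ E ℂ)
    ((normSeminorm ℂ ℂ).comp T.toLinearMap) (continuous_norm.comp T.continuous)
  choose C K hC hK hCK using fun p : ℕ × ℕ => exists_seminorm_pow_mul_le h g p.1 p.2
  have hsum : 0 ≤ ∑ p ∈ s, K p := Finset.sum_nonneg fun p _ => hK p
  refine ⟨B * ∑ p ∈ s, C p, ∑ p ∈ s, K p,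
    mul_nonneg B.2 (Finset.sum_nonneg fun p _ => hC p), hsum, fun m => ?_⟩
  refine (hB _).trans ?_
  rw [mul_assoc]
  change (B : ℝ) * (s.sup (schwartzSeminormFamily ℂ E ℂ)) _ ≤ _
  gcongr
  have hsumC : 0 ≤ ∑ p ∈ s, C p := Finset.sum_nonneg fun p _ => hC p
  refine Seminorm.finset_sup_apply_le (by positivity) fun p hp => ?_
  refine (hCK p m).trans ?_
  have h1 : C p ≤ ∑ p ∈ s, C p := Finset.single_le_sum (fun p _ => hC p) hp
  have h2 : K p ≤ ∑ p ∈ s, K p := Finset.single_le_sum (fun p _ => hK p) hp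
  have := hK p
  gcongr

/-- For a tempered distribution `T`, the function `t ↦ T (exp (t h) g)` is entire and of exponential
type. -/
theorem differentiable_and_bound_exp_mul (T : 𝓢(E, ℂ) →L[ℂ] ℂ) (h g : 𝓢(E, ℂ))
    {G : ℂ → 𝓢(E, ℂ)} (hG : ∀ t x, G t x = Complex.exp (t * h x) * g x) :
    Differentiable ℂ (fun t => T (G t)) ∧
      ∃ C K : ℝ, ∀ t, ‖T (G t)‖ ≤ C * Real.exp (K * ‖t‖) := by
  obtain ⟨C, K, hC, hK, hCK⟩ := exists_norm_pow_le T h g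
  set a : ℕ → ℂ := fun m => T ((smulLeftCLM ℂ h)^[m] g) / (m.factorial : ℂ) with ha
  have hS : ∀ t, HasSum (fun m => t ^ m * a m) (T (G t)) := by
    intro t
    have := T.hasSum (hasSum_exp_mul h g t (hG t))
    refine this.congr_fun fun m => ?_
    simp only [map_smul, smul_eq_mul, ha]
    ring
  have hb : ∀ (t : ℂ) m, ‖t ^ m * a m‖ ≤ C * ((K * ‖t‖) ^ m / m.factorial) := by
    intro t m
    rw [norm_mul, norm_pow, ha, norm_div, Complex.norm_natCast, mul_pow]
    calc _ ≤ ‖t‖ ^ m * (C * K ^ m / m.factorial) := by gcongr; exact hCK m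
      _ = _ := by ring
  constructor
  · have e : (fun t => T (G t)) = fun t => ∑' m, t ^ m * a m := funext fun t => (hS t).tsum_eq.symm
    rw [e]
    intro t
    have hU : DifferentiableOn ℂ (fun t => ∑' m, t ^ m * a m) (Metric.ball 0 (‖t‖ + 1)) := by
      refine Complex.differentiableOn_tsum_of_summable_norm
        (u := fun m => C * ((K * (‖t‖ + 1)) ^ m / m.factorial))
        ((Real.summable_pow_div_factorial _).mul_left C) (fun m => by fun_prop)
        Metric.isOpen_ball fun m w hw => (hb w m).trans ?_
      have : ‖w‖ ≤ ‖t‖ + 1 := by simpa using (Metric.mem_ball.1 hw).le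
      gcongr
    exact hU.differentiableAt (Metric.isOpen_ball.mem_nhds (by simp))
  · refine ⟨C, K, fun t => ?_⟩
    rw [← (hS t).tsum_eq]
    refine tsum_of_norm_bounded ?_ (hb t)
    have := NormedSpace.expSeries_div_hasSum_exp (K * ‖t‖)
    rw [← Real.exp_eq_exp_ℝ] at this
    exact this.mul_left C

end SchwartzMap

/-- The point of the Euclidean plane with integer coordinates `n`. -/
def intVec (n : Fin 2 → ℤ) : EuclideanSpace ℝ (Fin 2) := WithLp.toLp 2 fun i => (n i : ℝ)

theorem norm_le_norm_intVec (n : Fin 2 → ℤ) : ‖n‖ ≤ ‖intVec n‖ := by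
  refine (pi_norm_le_iff_of_nonneg (norm_nonneg _)).2 fun i => ?_
  have := PiLp.norm_apply_le (intVec n) i
  rw [← Int.norm_cast_real]
  simpa [intVec] using this

theorem summable_one_add_norm_pow_mul (ψ : 𝓢(EuclideanSpace ℝ (Fin 2), ℂ)) (k : ℕ) :
    Summable fun n : Fin 2 → ℤ => (1 + ‖intVec n‖) ^ k * ‖ψ (intVec n)‖ := by
  set C := 2 ^ (k + 3) * ((Finset.Iic (k + 3, 0)).sup fun m => SchwartzMap.seminorm ℂ m.1 m.2) ψ
    with hC
  have hb : ∀ x, (1 + ‖x‖) ^ (k + 3) * ‖ψ x‖ ≤ C := by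
    intro x
    have := SchwartzMap.one_add_le_sup_seminorm_apply (𝕜 := ℂ) (m := (k + 3, 0)) (k := k + 3)
      (n := 0) le_rfl le_rfl ψ x
    simpa using this
  refine Summable.of_norm_bounded_eventually
    ((EisensteinSeries.summable_one_div_norm_rpow (k := 3) (by norm_num)).mul_left C) ?_
  filter_upwards [Filter.eventually_cofinite_ne (0 : Fin 2 → ℤ)] with n hn
  have hn' : 0 < ‖n‖ := norm_pos_iff.2 hn
  rw [Real.rpow_neg hn'.le, show (3 : ℝ) = (3 : ℕ) by norm_num, Real.rpow_natCast,
    ← div_eq_mul_inv, le_div_iff₀ (by positivity), Real.norm_of_nonneg (by positivity)]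
  refine le_trans ?_ (hb (intVec n))
  have h1 : ‖n‖ ≤ 1 + ‖intVec n‖ := (norm_le_norm_intVec n).trans (by linarith)
  calc _ ≤ (1 + ‖intVec n‖) ^ k * ‖ψ (intVec n)‖ * (1 + ‖intVec n‖) ^ 3 := by gcongr
    _ = _ := by ring

/-- A continuous function supported in `[-1/4, 1/4]²` has a continuous periodization. -/
theorem continuous_comp_equivIoc {φ : EuclideanSpace ℝ (Fin 2) → ℂ} (hφ : Continuous φ)
    (hs : ∀ x, φ x ≠ 0 → ∀ i, |x i| ≤ 1 / 4) :
    Continuous fun p : UnitAddTorus (Fin 2) =>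
      φ (WithLp.toLp 2 fun i => (AddCircle.equivIoc (1 : ℝ) (-1 / 2) (p i)).1) := by
  rw [continuous_iff_continuousAt]
  intro p
  by_cases hp : ∀ i, p i ≠ ((-1 / 2 : ℝ) : UnitAddCircle)
  · refine hφ.continuousAt.comp ((PiLp.continuous_toLp 2 _).continuousAt.comp ?_)
    refine continuousAt_pi.2 fun i => ?_
    have h1 := AddCircle.continuousAt_equivIoc (1 : ℝ) (-1 / 2) (hp i)
    exact continuous_subtype_val.continuousAt.comp
      (ContinuousAt.comp (f := fun q : UnitAddTorus (Fin 2) => q i) h1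
        (continuous_apply i).continuousAt)
  · push Not at hp
    obtain ⟨i, hi⟩ := hp
    have hopen : IsOpen {q : UnitAddTorus (Fin 2) | 1 / 4 < ‖q i‖} :=
      isOpen_lt continuous_const ((continuous_apply i).norm)
    have hmem : p ∈ {q : UnitAddTorus (Fin 2) | 1 / 4 < ‖q i‖} := by
      have : ‖((-1 / 2 : ℝ) : UnitAddCircle)‖ = 1 / 2 := by
        rw [(AddCircle.norm_coe_eq_abs_iff _ one_ne_zero).2 (by norm_num [abs_div])]
        norm_num [abs_div]
      simp only [Set.mem_ofPred_eq, hi, this]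
      norm_num
    refine (continuousAt_const (y := (0 : ℂ))).congr ?_
    filter_upwards [hopen.mem_nhds hmem] with q hq
    by_contra hne
    have h1 := hs _ (Ne.symm hne) i
    simp only at h1
    have h2 : ((AddCircle.equivIoc (1 : ℝ) (-1 / 2) (q i)).1 : UnitAddCircle) = q i :=
      (AddCircle.equivIoc (1 : ℝ) (-1 / 2)).symm_apply_apply (q i)
    have h3 : ‖q i‖ ≤ |(AddCircle.equivIoc (1 : ℝ) (-1 / 2) (q i)).1| := by
      conv_lhs => rw [← h2]
      exact QuotientAddGroup.norm_mk_le_norm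
    have h4 : 1 / 4 < ‖q i‖ := hq
    linarith

theorem mFourier_coe (n : Fin 2 → ℤ) (x : Fin 2 → ℝ) :
    UnitAddTorus.mFourier n (fun i => (x i : UnitAddCircle)) =
      Complex.exp (2 * Real.pi * Complex.I * (inner ℝ (intVec n) (WithLp.toLp 2 x) : ℝ)) := by
  simp only [UnitAddTorus.mFourier, ContinuousMap.coe_mk, Fin.prod_univ_two, fourier_coe_apply,
    ← Complex.exp_add]
  congr 1
  simp [intVec, PiLp.inner_apply, Fin.sum_univ_two]
  ring

/-- Fourier series expansion on `[-1/4, 1/4]²` of a Schwartz function supported there. -/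
theorem hasSum_fourier_intVec (φ : 𝓢(EuclideanSpace ℝ (Fin 2), ℂ))
    (hs : ∀ x, φ x ≠ 0 → ∀ i, |x i| ≤ 1 / 4) {x : EuclideanSpace ℝ (Fin 2)}
    (hx : ∀ i, |x i| ≤ 1 / 4) :
    HasSum (fun n => 𝓕 φ (intVec n) *
      Complex.exp (2 * Real.pi * Complex.I * (inner ℝ (intVec n) x : ℝ))) (φ x) := by
  set f : C(UnitAddTorus (Fin 2), ℂ) := ⟨_, continuous_comp_equivIoc φ.continuous hs⟩ with hf
  have hval : ∀ y : Fin 2 → ℝ, (∀ i, y i ∈ Set.Ioc (-1 / 2 : ℝ) (-1 / 2 + 1)) →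
      f (fun i => (y i : UnitAddCircle)) = φ (WithLp.toLp 2 y) := by
    intro y hy
    simp only [hf, ContinuousMap.coe_mk]
    congr 2
    funext i
    rw [AddCircle.equivIoc_coe_of_mem]
    exact hy i
  have hsmall : ∀ t : ℝ, |t| ≤ 1 / 4 → t ∈ Set.Ioc (-1 / 2 : ℝ) (-1 / 2 + 1) := by
    intro t ht
    have := abs_le.1 ht
    constructor <;> linarith
  have hcoeff : ∀ n, UnitAddTorus.mFourierCoeff f n = 𝓕 φ (intVec n) := by
    intro n
    rw [UnitAddTorus.mFourierCoeff_eq_integral f n fun _ => -1 / 2, SchwartzMap.fourier_coe,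
      Real.fourier_eq',
      ← (EuclideanSpace.volume_preserving_symm_measurableEquiv_toLp (Fin 2)).symm.integral_comp']
    have hmeas : MeasurableSet {y : Fin 2 → ℝ | ∀ i, y i ∈ Set.Ioc (-1 / 2 : ℝ) (-1 / 2 + 1)} :=
      MeasurableSet.univ_pi' fun i => measurableSet_Ioc
    rw [← integral_indicator hmeas]
    refine integral_congr_ae (Filter.Eventually.of_forall fun y => ?_)
    simp only [Set.indicator]
    split_ifs with hy
    · rw [hval y hy, mFourier_coe]
      simp only [smul_eq_mul]
      change _ = cexp (↑(-2 * π * inner ℝ (WithLp.toLp 2 y) (intVec n)) * I) *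
        φ (WithLp.toLp 2 y)
      congr 2
      simp [intVec, PiLp.inner_apply, Fin.sum_univ_two]
      ring
    · have : φ (WithLp.toLp 2 y) = 0 := by
        by_contra hne
        exact hy fun i => hsmall _ (hs _ hne i)
      change 0 = _ • φ (WithLp.toLp 2 y)
      rw [this, smul_zero]
  have hsum : Summable (UnitAddTorus.mFourierCoeff f) := by
    refine Summable.of_norm ?_
    simpa [hcoeff] using summable_one_add_norm_pow_mul (𝓕 φ) 0
  have := UnitAddTorus.hasSum_mFourier_series_apply_of_summable hsum
    fun i => ((x i : ℝ) : UnitAddCircle)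
  rw [hval _ fun i => hsmall _ (hx i)] at this
  simpa only [hcoeff, mFourier_coe, smul_eq_mul] using this

theorem fourier_tf_gauss (r s : ℝ) (η : EuclideanSpace ℝ (Fin 1)) :
    𝓕 (tf (WithLp.toLp 2 fun _ => r) (WithLp.toLp 2 fun _ => s) gauss) η =
      cexp (-π * (η 0 - s) ^ 2 - 2 * π * I * r * (η 0 - s)) := by
  have mp : MeasurePreserving ((MeasurableEquiv.funUnique (Fin 1) ℝ).symm.trans
      (MeasurableEquiv.toLp 2 (Fin 1 → ℝ)).symm.symm) :=
    (EuclideanSpace.volume_preserving_symm_measurableEquiv_toLp (Fin 1)).symm.comp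
      (by convert! (MeasureTheory.volume_preserving_funUnique (Fin 1) ℝ).symm)
  rw [Real.fourier_eq', ← mp.integral_comp']
  have e : ∀ t : ℝ, cexp (-(π : ℂ) * t ^ 2 + (2 * π * I * (s - η 0) + 2 * π * r) * t + -π * r ^ 2) =
      cexp (↑(-2 * π * inner ℝ (WithLp.toLp 2 fun _ : Fin 1 => t) η) * I) •
      tf (WithLp.toLp 2 fun _ => r) (WithLp.toLp 2 fun _ => s) gauss
        (WithLp.toLp 2 fun _ => t) := by
    intro t
    simp only [tf, gauss, smul_eq_mul, Complex.ofReal_exp, ← Complex.exp_add]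
    congr 1
    simp [PiLp.inner_apply]
    ring
  calc _ = ∫ t : ℝ,
        cexp (-(π : ℂ) * t ^ 2 + (2 * π * I * (s - η 0) + 2 * π * r) * t + -π * r ^ 2) :=
        integral_congr_ae (Filter.Eventually.of_forall fun t => (e t).symm)
    _ = _ := by
      have hpi : (π : ℂ) ≠ 0 := by exact_mod_cast Real.pi_ne_zero
      rw [integral_cexp_quadratic (by simpa using Real.pi_pos), neg_neg, div_self hpi,
        Complex.one_cpow, one_mul]
      congr 1
      field_simp
      ring_nf
      simp only [Complex.I_sq]
      ring

/-- The exponent of the Gaussian kernel arising from Rihaczek distributions of Gaussians. -/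
def kernelExp (u₁ u₂ : ℂ) (z : EuclideanSpace ℝ (Fin (1 + 1))) : ℂ :=
  -π * ((z 0 : ℂ) ^ 2 + (z 1 : ℂ) ^ 2) + 2 * π * I * z 0 * z 1 + 2 * π * (u₁ * z 0 + u₂ * z 1)

theorem exists_conj_rihaczek_eq (p q r s : ℝ) : ∃ c : ℂ, c ≠ 0 ∧ ∀ z,
    (starRingEnd ℂ) (rihaczek (tf (WithLp.toLp 2 fun _ => p) (WithLp.toLp 2 fun _ => q) gauss)
      (tf (WithLp.toLp 2 fun _ => r) (WithLp.toLp 2 fun _ => s) gauss) z) =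
      c * cexp (kernelExp (p - I * q) (s - I * r) z) := by
  refine ⟨cexp (-π * p ^ 2 - π * s ^ 2 + 2 * π * I * r * s), Complex.exp_ne_zero _, fun z => ?_⟩
  simp only [rihaczek, fourier_tf_gauss, tf, gauss, Complex.ofReal_exp,
    ← Complex.exp_conj, ← Complex.exp_add]
  congr 1
  have h0 : (zx z) 0 = z 0 := rfl
  have h1 : (zxi z) 0 = z 1 := rfl
  simp [PiLp.inner_apply, h0, h1, kernelExp, Complex.conj_ofNat]
  ring

theorem integral_exp_kernelExp {u₁ u₂ : ℂ} (hint : Integrable fun z => cexp (kernelExp u₁ u₂ z)) :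
    ∫ z, cexp (kernelExp u₁ u₂ z) =
      (1 / 2 : ℂ) ^ (1 / 2 : ℂ) * cexp (π / 2 * (u₁ ^ 2 + u₂ ^ 2 + 2 * I * u₁ * u₂)) := by
  have hpi : (π : ℂ) ≠ 0 := by exact_mod_cast Real.pi_ne_zero
  have mp1 := (EuclideanSpace.volume_preserving_symm_measurableEquiv_toLp (Fin 2)).symm
  have mp2 := (MeasureTheory.volume_preserving_finTwoArrow ℝ).symm
  have mp := mp1.comp mp2
  set e := (MeasurableEquiv.finTwoArrow (α := ℝ)).symm.trans
    (MeasurableEquiv.toLp 2 (Fin 2 → ℝ)).symm.symm with he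
  have mp' : MeasurePreserving e := mp
  have hev : ∀ p : ℝ × ℝ, kernelExp u₁ u₂ (e p) = (-(π : ℂ) * p.1 ^ 2 +
      (2 * π * (u₁ + I * p.2)) * p.1 + (-π * p.2 ^ 2 + 2 * π * u₂ * p.2)) := by
    intro p
    have h0 : (e p) 0 = p.1 := rfl
    have h1 : (e p) 1 = p.2 := rfl
    rw [kernelExp]
    erw [h0, h1]
    ring
  have hint' := mp'.integrable_comp_of_integrable hint
  calc _ = ∫ p : ℝ × ℝ, cexp (kernelExp u₁ u₂ (e p)) := (mp'.integral_comp' _).symm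
    _ = ∫ y : ℝ, ∫ x : ℝ, cexp (kernelExp u₁ u₂ (e (x, y))) :=
        integral_prod_symm _ hint'
    _ = ∫ y : ℝ, cexp (-(2 * π : ℂ) * y ^ 2 + (2 * π * (u₂ + I * u₁)) * y + π * u₁ ^ 2) := by
        congr 1
        funext y
        simp only [hev]
        rw [integral_cexp_quadratic (by simpa using Real.pi_pos), neg_neg, div_self hpi,
          Complex.one_cpow, one_mul]
        congr 1
        field_simp
        ring_nf
        simp only [Complex.I_sq]
        ring
    _ = _ := by
        rw [integral_cexp_quadratic (by simpa using Real.pi_pos), neg_neg]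
        congr 2
        · field_simp
        · field_simp
          ring_nf
          simp only [Complex.I_sq]
          ring

theorem iteratedDeriv_cexp_mul_ofReal (c : ℂ) (n : ℕ) :
    iteratedDeriv n (fun t : ℝ => cexp (c * t)) = fun t : ℝ => c ^ n * cexp (c * t) := by
  induction n with
  | zero => simp
  | succ n ih =>
    rw [iteratedDeriv_succ, ih]
    funext t
    have h1 : HasDerivAt (fun t : ℝ => c * (t : ℂ)) (c * 1) t :=
      (HasDerivAt.ofReal_comp (hasDerivAt_id t)).const_mul c
    rw [(h1.cexp.const_mul (c ^ n)).deriv]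
    ring

/-- The derivatives of the character `x ↦ exp (2πi⟨v, x⟩)` are bounded by powers of `2π‖v‖`. -/
theorem norm_iteratedFDeriv_cexp_inner_le {E : Type*} [NormedAddCommGroup E]
    [InnerProductSpace ℝ E] (v x : E) (n : ℕ) :
    ‖iteratedFDeriv ℝ n (fun x => cexp (2 * π * I * (inner ℝ v x : ℝ))) x‖ ≤
      (2 * π * ‖v‖) ^ n := by
  have hs : ContDiff ℝ ∞ fun t : ℝ => cexp (2 * π * I * t) :=
    (contDiff_const.mul Complex.ofRealCLM.contDiff).cexp
  have h := (innerSL ℝ v).iteratedFDeriv_comp_right hs x (i := n) (by exact_mod_cast le_top)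
  change ‖iteratedFDeriv ℝ n ((fun t : ℝ => cexp (2 * π * I * t)) ∘ innerSL ℝ v) x‖ ≤ _
  rw [h]
  refine (ContinuousMultilinearMap.norm_compContinuousLinearMap_le _ _).trans ?_
  rw [norm_iteratedFDeriv_eq_norm_iteratedDeriv, iteratedDeriv_cexp_mul_ofReal]
  have h1 : ‖cexp (2 * π * I * (innerSL ℝ v x : ℝ))‖ = 1 := by
    rw [show (2 * π * I * (innerSL ℝ v x : ℝ) : ℂ) = ((2 * π * innerSL ℝ v x : ℝ) : ℂ) * I by
      push_cast; ring]
    exact Complex.norm_exp_ofReal_mul_I _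
  rw [norm_mul, h1, norm_pow]
  simp [mul_pow, abs_of_pos Real.pi_pos]

/-- A distribution vanishing on functions supported off `S` only depends on the restriction of a
test function to an open neighbourhood of `S`. -/
theorem SchwartzMap.apply_eq_of_eqOn {E : Type*}
    [NormedAddCommGroup E] [NormedSpace ℝ E] {τ : SchwartzMap E ℂ →L[ℂ] ℂ} {S U : Set E}
    (hU : IsOpen U) (hSU : S ⊆ U)
    (hτ : ∀ ψ : SchwartzMap E ℂ, Disjoint (tsupport ψ) S → τ ψ = 0)
    {ψ ψ' : SchwartzMap E ℂ} (h : Set.EqOn ψ ψ' U) : τ ψ = τ ψ' := by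
  rw [← sub_eq_zero, ← map_sub]
  refine hτ _ (Set.disjoint_left.2 fun x hx hxS => ?_)
  have : tsupport (ψ - ψ' : SchwartzMap E ℂ) ⊆ Uᶜ := by
    refine closure_minimal (fun y hy hyU => hy ?_) hU.isClosed_compl
    simp [h hyU]
  exact this hx (hSU hxS)

section

variable {E : Type*} [NormedAddCommGroup E] [NormedSpace ℝ E] [FiniteDimensional ℝ E]
  [HasContDiffBump E]

/-- The Schwartz function `χ u` for a bump function `χ` and a smooth function `u`. -/
def ContDiffBump.mulSchwartz {c : E} (χ : ContDiffBump c) (u : E → ℂ) (hu : ContDiff ℝ ∞ u) :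
    SchwartzMap E ℂ :=
  HasCompactSupport.toSchwartzMap (f := fun x => (χ x : ℂ) * u x)
    (HasCompactSupport.mul_right (f := fun x => (χ x : ℂ))
      (χ.hasCompactSupport.comp_left (g := fun t : ℝ => (t : ℂ)) Complex.ofReal_zero))
    ((Complex.ofRealCLM.contDiff.comp χ.contDiff).mul hu)

theorem ContDiffBump.mulSchwartz_apply {c : E} (χ : ContDiffBump c) (u : E → ℂ)
    (hu : ContDiff ℝ ∞ u) (x : E) : χ.mulSchwartz u hu x = χ x * u x := rfl

/-- If a distribution with compact support annihilates the functions `exp (q + w₁ h₁ + w₂ h₂)` for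
all lattice points `(w₁, w₂)`, it does so for all complex `(w₁, w₂)`. -/
theorem exists_apply_eq_zero_of_lattice {τ : SchwartzMap E ℂ →L[ℂ] ℂ} {S : Set E} {R : ℝ}
    (hR : 0 < R) (hSR : S ⊆ Metric.ball 0 R)
    (hτ : ∀ ψ : SchwartzMap E ℂ, Disjoint (tsupport ψ) S → τ ψ = 0)
    {q h₁ h₂ : E → ℂ} (hq : ContDiff ℝ ∞ q) (hh₁ : ContDiff ℝ ∞ h₁) (hh₂ : ContDiff ℝ ∞ h₂)
    {a b : ℝ} (ha : 0 < a) (hb : 0 < b)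
    (h0 : ∀ k l m n : ℤ, ∃ ψ : SchwartzMap E ℂ, τ ψ = 0 ∧ ∃ c : ℂ, c ≠ 0 ∧ ∀ x,
      ψ x = c * cexp (q x + (a * k - I * (b * l)) * h₁ x + (b * n - I * (a * m)) * h₂ x))
    (w₁ w₂ : ℂ) :
    ∃ ψ : SchwartzMap E ℂ, τ ψ = 0 ∧
      Set.EqOn ψ (fun x => cexp (q x + w₁ * h₁ x + w₂ * h₂ x)) (Metric.ball 0 R) := by
  let χ : ContDiffBump (0 : E) := ⟨R, R + 1, hR, by linarith⟩
  have hχ : ∀ x ∈ Metric.ball (0 : E) R, χ x = 1 := fun x hx =>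
    χ.one_of_mem_closedBall (Metric.ball_subset_closedBall hx)
  set H₁ := χ.mulSchwartz h₁ hh₁ with hH₁
  set H₂ := χ.mulSchwartz h₂ hh₂ with hH₂
  have hH₁s : ContDiff ℝ ∞ H₁ := H₁.smooth ⊤
  have hH₂s : ContDiff ℝ ∞ H₂ := H₂.smooth ⊤
  let G : ℂ → ℂ → SchwartzMap E ℂ := fun w₁ w₂ =>
    χ.mulSchwartz (fun x => cexp (q x + w₁ * H₁ x + w₂ * H₂ x))
      ((hq.add (contDiff_const.mul hH₁s)).add (contDiff_const.mul hH₂s)).cexp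
  have hG : ∀ w₁ w₂ x, G w₁ w₂ x = χ x * cexp (q x + w₁ * H₁ x + w₂ * H₂ x) := fun _ _ _ => rfl
  have hGon : ∀ w₁ w₂, Set.EqOn (G w₁ w₂) (fun x => cexp (q x + w₁ * h₁ x + w₂ * h₂ x))
      (Metric.ball 0 R) := by
    intro w₁ w₂ x hx
    simp [hG, hH₁, hH₂, ContDiffBump.mulSchwartz_apply, hχ x hx]
  have hlat : ∀ k l m n : ℤ, τ (G (a * k - I * (b * l)) (b * n - I * (a * m))) = 0 := by
    intro k l m n
    obtain ⟨ψ, hψ, c, hc, hψc⟩ := h0 k l m n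
    rw [SchwartzMap.apply_eq_of_eqOn (ψ' := c⁻¹ • ψ) Metric.isOpen_ball hSR hτ, map_smul, hψ,
      smul_zero]
    intro x hx
    rw [hGon _ _ hx, _root_.smul_apply, hψc, smul_eq_mul, inv_mul_cancel_left₀ hc]
  have hfst : ∀ (w : ℂ) (m n : ℤ), τ (G w (b * n - I * (a * m))) = 0 := by
    intro w m n
    obtain ⟨hd, C, K, hCK⟩ := SchwartzMap.differentiable_and_bound_exp_mul τ H₁
      (G 0 (b * n - I * (a * m))) (G := fun t => G t (b * n - I * (a * m))) (by
        intro t x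
        rw [hG, hG, mul_left_comm (cexp _), ← Complex.exp_add]
        ring_nf)
    exact eq_zero_of_exponential_type_of_lattice hd hCK ha hb (fun k l => hlat k l m n) w
  refine ⟨G w₁ w₂, ?_, hGon w₁ w₂⟩
  obtain ⟨hd, C, K, hCK⟩ := SchwartzMap.differentiable_and_bound_exp_mul τ H₂
    (G w₁ 0) (G := fun t => G w₁ t) (by
      intro t x
      rw [hG, hG, mul_left_comm (cexp _), ← Complex.exp_add]
      ring_nf)
  exact eq_zero_of_exponential_type_of_lattice hd hCK hb ha (fun n m => hfst w₁ m n) w₂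

end

/-- A compactly supported distribution on the plane annihilating all functions which agree with
`x ↦ exp (q x + 2πi⟨y, x⟩)` near its support is zero. -/
theorem apply_eq_zero_of_forall_character
    {τ : SchwartzMap (EuclideanSpace ℝ (Fin 2)) ℂ →L[ℂ] ℂ}
    {S : Set (EuclideanSpace ℝ (Fin 2))} {R : ℝ} (hR : 0 < R) (hSR : S ⊆ Metric.ball 0 R)
    (hτ : ∀ ψ : SchwartzMap (EuclideanSpace ℝ (Fin 2)) ℂ, Disjoint (tsupport ψ) S → τ ψ = 0)
    {q : EuclideanSpace ℝ (Fin 2) → ℂ} (hq : ContDiff ℝ ∞ q)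
    (h0 : ∀ y : EuclideanSpace ℝ (Fin 2), ∃ ψ : SchwartzMap (EuclideanSpace ℝ (Fin 2)) ℂ,
      τ ψ = 0 ∧ Set.EqOn ψ (fun x => cexp (q x + 2 * π * I * (inner ℝ y x : ℝ)))
        (Metric.ball 0 R))
    (ψ : SchwartzMap (EuclideanSpace ℝ (Fin 2)) ℂ) : τ ψ = 0 := by
  let χ : ContDiffBump (0 : EuclideanSpace ℝ (Fin 2)) := ⟨R, R + 1, hR, by linarith⟩
  have hχ : ∀ x ∈ Metric.ball (0 : EuclideanSpace ℝ (Fin 2)) R, χ x = 1 := fun x hx =>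
    χ.one_of_mem_closedBall (Metric.ball_subset_closedBall hx)
  have hχ0 : ∀ x, χ x ≠ 0 → ‖x‖ < R + 1 := by
    intro x hx
    by_contra! h
    exact hx (χ.zero_of_le_dist (by simpa [χ] using h))
  set L : ℝ := 4 * (R + 1) with hL
  have hL0 : 0 < L := by positivity
  have hL1 : L⁻¹ ≤ 1 := inv_le_one_of_one_le₀ (by linarith)
  set φ := χ.mulSchwartz (fun x => cexp (-q x) * ψ x) (hq.neg.cexp.mul (ψ.smooth ⊤)) with hφ
  let φL : SchwartzMap (EuclideanSpace ℝ (Fin 2)) ℂ :=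
    SchwartzMap.compCLMOfContinuousLinearEquiv ℂ
      (ContinuousLinearEquiv.smulLeft (Units.mk0 L hL0.ne')) φ
  have hφL : ∀ x, φL x = φ (L • x) := fun x => rfl
  have hsmall : ∀ x : EuclideanSpace ℝ (Fin 2), χ x ≠ 0 → ∀ i, |(L⁻¹ • x) i| ≤ 1 / 4 := by
    intro x hx i
    have h1 := (PiLp.norm_apply_le x i).trans (hχ0 x hx).le
    rw [Real.norm_eq_abs] at h1
    rw [PiLp.smul_apply, smul_eq_mul, abs_mul, abs_inv, abs_of_pos hL0, inv_mul_le_iff₀ hL0]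
    linarith
  have hsupp : ∀ x, φL x ≠ 0 → ∀ i, |x i| ≤ 1 / 4 := by
    intro x hx
    have := hsmall (L • x) (by
      intro h
      apply hx
      rw [hφL, hφ, ContDiffBump.mulSchwartz_apply, h]
      simp)
    rwa [inv_smul_smul₀ hL0.ne'] at this
  let e : (Fin 2 → ℤ) → EuclideanSpace ℝ (Fin 2) → ℂ := fun n x =>
    cexp (2 * π * I * (inner ℝ (L⁻¹ • intVec n) x : ℝ))
  have he : ∀ n, ContDiff ℝ ∞ (e n) := fun n => (contDiff_const.mul
    (Complex.ofRealCLM.contDiff.comp (innerSL ℝ (L⁻¹ • intVec n)).contDiff)).cexp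
  let K : (Fin 2 → ℤ) → SchwartzMap (EuclideanSpace ℝ (Fin 2)) ℂ := fun n =>
    χ.mulSchwartz (fun x => e n x * cexp (q x)) ((he n).mul hq.cexp)
  have hK : ∀ n, τ (K n) = 0 := by
    intro n
    obtain ⟨ψ', hψ', hon⟩ := h0 (L⁻¹ • intVec n)
    rw [← hψ']
    refine SchwartzMap.apply_eq_of_eqOn Metric.isOpen_ball hSR hτ fun x hx => ?_
    rw [hon hx, ContDiffBump.mulSchwartz_apply, hχ x hx, ← Complex.exp_add, add_comm]
    simp
  set g := χ.mulSchwartz (fun x => cexp (q x)) hq.cexp with hg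
  set P := χ.mulSchwartz (fun x => cexp (q x) * φ x) (hq.cexp.mul (φ.smooth ⊤)) with hP
  have hsum : HasSum (fun n => 𝓕 φL (intVec n) • K n) P := by
    refine SchwartzMap.hasSum_of_summable_seminorm (fun k n => ?_) (fun x => ?_)
    · set N := ∑ i ∈ Finset.range (n + 1), SchwartzMap.seminorm ℂ k i g
      have hbound : ∀ p, SchwartzMap.seminorm ℂ k n (K p) ≤
          2 ^ n * (2 * π * (1 + ‖intVec p‖)) ^ n * N := by
        intro p
        refine SchwartzMap.seminorm_mul_le_of_bound (he p) g (K p) (fun x => ?_) k n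
          (Finset.sum_nonneg fun _ _ => apply_nonneg _ _) (fun i hi x => ?_) (fun i hi => ?_)
          n le_rfl
        · simp only [K, hg, ContDiffBump.mulSchwartz_apply]
          ring
        · refine (norm_iteratedFDeriv_cexp_inner_le _ x i).trans ?_
          have h1 : 1 ≤ 2 * π * (1 + ‖intVec p‖) := by
            nlinarith [Real.pi_gt_three, norm_nonneg (intVec p)]
          refine le_trans ?_ (pow_le_pow_right₀ h1 hi)
          gcongr
          rw [norm_smul, norm_inv, Real.norm_of_nonneg hL0.le]
          nlinarith [norm_nonneg (intVec p)]
        · exact Finset.single_le_sum (f := fun i => SchwartzMap.seminorm ℂ k i g)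
            (fun _ _ => apply_nonneg _ _) (Finset.mem_range.2 (by omega))
      refine Summable.of_nonneg_of_le (fun _ => apply_nonneg _ _) (fun p => ?_)
        ((summable_one_add_norm_pow_mul (𝓕 φL) n).mul_left (2 ^ n * (2 * π) ^ n * N))
      rw [map_smul_eq_mul]
      refine (mul_le_mul_of_nonneg_left (hbound p) (norm_nonneg _)).trans_eq ?_
      rw [mul_pow]
      ring
    · by_cases hx : χ x = 0
      · simp [K, hP, ContDiffBump.mulSchwartz_apply, hx, hasSum_zero]
      · have h1 := (hasSum_fourier_intVec φL hsupp (hsmall x hx)).mul_left (χ x * cexp (q x))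
        rw [hφL, smul_inv_smul₀ hL0.ne'] at h1
        convert! h1 using 1
        · funext n
          simp only [K, e, _root_.smul_apply, ContDiffBump.mulSchwartz_apply, smul_eq_mul,
            real_inner_smul_left, real_inner_smul_right]
          ring
        · rw [hP, ContDiffBump.mulSchwartz_apply]
          ring
  have hPτ : τ P = 0 := by
    refine (hsum.mapL τ).unique ?_
    simp [hK, hasSum_zero]
  rw [← hPτ]
  refine SchwartzMap.apply_eq_of_eqOn Metric.isOpen_ball hSR hτ fun x hx => ?_
  rw [hP, ContDiffBump.mulSchwartz_apply, hφ, ContDiffBump.mulSchwartz_apply, hχ x hx,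
    Complex.ofReal_one, one_mul, one_mul, ← mul_assoc, ← Complex.exp_add, add_neg_cancel,
    Complex.exp_zero, one_mul]

theorem quadratic_shift_eq (w₁ w₂ x y : ℂ) :
    (π / 2 * ((w₁ + I * x) ^ 2 + (w₂ + I * y) ^ 2 + 2 * I * (w₁ + I * x) * (w₂ + I * y)) : ℂ) =
      π / 2 * (w₁ ^ 2 + w₂ ^ 2 + 2 * I * w₁ * w₂) +
        (-(π / 2) * (x ^ 2 + y ^ 2 + 2 * I * x * y) + w₁ * (π * I * (x + I * y)) +
          w₂ * (π * I * (y + I * x))) := by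
  ring_nf
  simp only [Complex.I_sq, show I ^ 3 = -I by rw [pow_succ, I_sq]; ring]
  ring

/-- The inverse Fourier transform of the conjugate Rihaczek distribution of two time-frequency
shifts of the Gaussian. -/
theorem exists_fourierInv_conj_rihaczek_eq (p q r s : ℝ)
    (f : SchwartzMap (EuclideanSpace ℝ (Fin (1 + 1))) ℂ)
    (hf : ∀ z, f z = (starRingEnd ℂ)
      (rihaczek (tf (WithLp.toLp 2 fun _ => p) (WithLp.toLp 2 fun _ => q) gauss)
        (tf (WithLp.toLp 2 fun _ => r) (WithLp.toLp 2 fun _ => s) gauss) z)) :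
    ∃ c : ℂ, c ≠ 0 ∧ ∀ ζ, (𝓕⁻ f) ζ = c * cexp (-(π / 2) * (ζ 0 ^ 2 + ζ 1 ^ 2 + 2 * I * ζ 0 * ζ 1) +
      (p - I * q) * (π * I * (ζ 0 + I * ζ 1)) + (s - I * r) * (π * I * (ζ 1 + I * ζ 0))) := by
  obtain ⟨c, hc, hcz⟩ := exists_conj_rihaczek_eq p q r s
  set w₁ : ℂ := p - I * q
  set w₂ : ℂ := s - I * r
  refine ⟨c * ((1 / 2 : ℂ) ^ (1 / 2 : ℂ) * cexp (π / 2 * (w₁ ^ 2 + w₂ ^ 2 + 2 * I * w₁ * w₂))),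
    mul_ne_zero hc (mul_ne_zero (by simp [Complex.cpow_eq_zero_iff]) (Complex.exp_ne_zero _)),
    fun ζ => ?_⟩
  have hshift : ∀ z : EuclideanSpace ℝ (Fin (1 + 1)),
      cexp (↑(2 * π * inner ℝ z ζ) * I) • f z =
        c * cexp (kernelExp (w₁ + I * ζ 0) (w₂ + I * ζ 1) z) := by
    intro z
    rw [hf, hcz, smul_eq_mul, mul_left_comm, ← Complex.exp_add]
    congr 2
    have : inner ℝ z ζ = z 0 * ζ 0 + z 1 * ζ 1 := by
      rw [PiLp.inner_apply, Fin.sum_univ_two]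
      simp [mul_comm]
    rw [this, kernelExp, kernelExp]
    push_cast
    ring
  have hint : Integrable fun z => cexp (kernelExp (w₁ + I * ζ 0) (w₂ + I * ζ 1) z) := by
    have h1 : Integrable fun z : EuclideanSpace ℝ (Fin (1 + 1)) =>
        cexp (↑(2 * π * inner ℝ z ζ) * I) • f z := by
      refine (f.integrable (μ := volume)).bdd_smul
        (φ := fun z => cexp (↑(2 * π * inner ℝ z ζ) * I)) 1
        (Continuous.aestronglyMeasurable (by fun_prop)) ?_
      exact Eventually.of_forall fun z => (Complex.norm_exp_ofReal_mul_I _).le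
    simp_rw [hshift] at h1
    exact (integrable_const_mul_iff (isUnit_iff_ne_zero.2 hc) _).1 h1
  rw [SchwartzMap.fourierInv_coe, Real.fourierInv_eq']
  simp_rw [hshift]
  rw [integral_const_mul, integral_exp_kernelExp hint, mul_assoc c,
    mul_assoc (_ ^ _), ← Complex.exp_add]
  rw [quadratic_shift_eq]

/-- let σ ∈ 𝒮′(ℝ²) have compactly supported distributional Fourier
transform.  If all entries H_{λμ} = ⟨σ, R(π(λ)φ, π(μ)φ)⟩ of the channel matrix with
respect to the Gaussian Gabor system over the lattice aℤ × bℤ vanish, then σ = 0.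
The Schwartz functions `Rb kl mn` are the conjugates of the Rihaczek distributions
R(π(λ)φ, π(μ)φ), so that σ (Rb kl mn) = ⟨σ, R(π(λ)φ, π(μ)φ)⟩. -/
theorem statement_6 (a b : ℝ) (ha : 0 < a) (hb : 0 < b)
    (σ : SchwartzMap (EuclideanSpace ℝ (Fin (1 + 1))) ℂ →L[ℂ] ℂ)
    (hσhat : ∃ S : Set (EuclideanSpace ℝ (Fin (1 + 1))), IsCompact S ∧
      ∀ ψ : SchwartzMap (EuclideanSpace ℝ (Fin (1 + 1))) ℂ,
        Disjoint (tsupport ⇑ψ) S → σ (SchwartzMap.fourierTransformCLM ℂ ψ) = 0)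
    (Rb : ℤ × ℤ → ℤ × ℤ → SchwartzMap (EuclideanSpace ℝ (Fin (1 + 1))) ℂ)
    (hRb : ∀ (kl mn : ℤ × ℤ) z, Rb kl mn z = (starRingEnd ℂ)
      (rihaczek (tf (vecd a fun _ => kl.1) (vecd b fun _ => kl.2) gauss)
                (tf (vecd a fun _ => mn.1) (vecd b fun _ => mn.2) gauss) z))
    (h0 : ∀ kl mn : ℤ × ℤ, σ (Rb kl mn) = 0) :
    σ = 0 := by
  have hinv : ∀ f : SchwartzMap (EuclideanSpace ℝ (Fin (1 + 1))) ℂ,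
      SchwartzMap.fourierTransformCLM ℂ (𝓕⁻ f) = f := fun f => by
    rw [SchwartzMap.fourierTransformCLM_apply, FourierTransform.fourier_fourierInv_eq]
  obtain ⟨S, hS, hSσ⟩ := hσhat
  obtain ⟨R, hR, hSR⟩ := hS.isBounded.subset_ball_lt 0 0
  set τ := σ.comp (SchwartzMap.fourierTransformCLM ℂ)
  let q : EuclideanSpace ℝ (Fin 2) → ℂ := fun ζ =>
    -(π / 2) * (ζ 0 ^ 2 + ζ 1 ^ 2 + 2 * I * ζ 0 * ζ 1)
  let h₁ : EuclideanSpace ℝ (Fin 2) → ℂ := fun ζ => π * I * (ζ 0 + I * ζ 1)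
  let h₂ : EuclideanSpace ℝ (Fin 2) → ℂ := fun ζ => π * I * (ζ 1 + I * ζ 0)
  have hcoord : ∀ i, ContDiff ℝ ∞ fun ζ : EuclideanSpace ℝ (Fin 2) => ((ζ i : ℝ) : ℂ) := fun i =>
    Complex.ofRealCLM.contDiff.comp
      (EuclideanSpace.proj i : EuclideanSpace ℝ (Fin 2) →L[ℝ] ℝ).contDiff
  have hc0 := hcoord 0
  have hc1 := hcoord 1
  have hq : ContDiff ℝ ∞ q := by fun_prop
  have hh₁ : ContDiff ℝ ∞ h₁ := by fun_prop
  have hh₂ : ContDiff ℝ ∞ h₂ := by fun_prop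
  have hlat : ∀ k l m n : ℤ, ∃ ψ : SchwartzMap (EuclideanSpace ℝ (Fin 2)) ℂ, τ ψ = 0 ∧
      ∃ c : ℂ, c ≠ 0 ∧ ∀ ζ, ψ ζ =
        c * cexp (q ζ + (a * k - I * (b * l)) * h₁ ζ + (b * n - I * (a * m)) * h₂ ζ) := by
    intro k l m n
    refine ⟨𝓕⁻ (Rb (k, l) (m, n)), ?_, ?_⟩
    · exact (congrArg σ (hinv _)).trans (h0 _ _)
    · simpa only [Complex.ofReal_mul, Complex.ofReal_intCast] using
        exists_fourierInv_conj_rihaczek_eq (a * k) (b * l) (a * m) (b * n) _ (hRb (k, l) (m, n))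
  have hzero := apply_eq_zero_of_forall_character hR hSR hSσ hq fun y => by
    obtain ⟨ψ, hψ, hon⟩ := exists_apply_eq_zero_of_lattice hR hSR hSσ hq hh₁ hh₂ ha hb hlat
      (y 0 - I * y 1) (y 1 - I * y 0)
    refine ⟨ψ, hψ, fun x hx => ?_⟩
    rw [hon hx]
    have : inner ℝ y x = y 0 * x 0 + y 1 * x 1 := by
      rw [PiLp.inner_apply, Fin.sum_univ_two]
      simp [mul_comm]
    simp only [this, h₁, h₂, add_assoc]
    congr 2
    push_cast
    ring_nf
    simp only [show I ^ 3 = -I by rw [pow_succ, I_sq]; ring]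
    ring
  ext f
  rw [← hinv f]
  exact hzero (𝓕⁻ f)
end
end

section
/- Let f, g ∈ 𝒮(ℝ^d). Then the Fourier transform of the Rihaczek distribution R(f,g) satisfies, for all (ξ, x) ∈ ℝ^d × ℝ^d, ℱ(R(f,g))(ξ, x) = V_g f(−x, ξ); that is, ℱ(R(f,g)) = 𝒰(V_g f) where 𝒰F(ξ,x) = F(−x,ξ). -/
noncomputable section

open MeasureTheory Complex Filter Real
open scoped FourierTransform Convolution Topology ENNReal

/-- the splitting z ↦ (x, ξ) of ℝ^{d+d} as a measurable equivalence -/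
def splitEquiv (d : ℕ) : EuclideanSpace ℝ (Fin (d + d)) ≃ᵐ
    EuclideanSpace ℝ (Fin d) × EuclideanSpace ℝ (Fin d) :=
  ((LinearIsometryEquiv.piLpCongrLeft 2 ℝ ℝ finSumFinEquiv.symm).trans
    (PiLp.sumPiLpEquivProdLpPiLp 2 fun _ : Fin d ⊕ Fin d => ℝ)).toMeasurableEquiv.trans
    (MeasurableEquiv.toLp 2 (EuclideanSpace ℝ (Fin d) × EuclideanSpace ℝ (Fin d))).symm

theorem measurePreserving_splitEquiv (d : ℕ) :
    MeasurePreserving (splitEquiv d) volume (volume.prod volume) :=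
  (LinearIsometryEquiv.measurePreserving _).trans
    (WithLp.volume_preserving_symm_measurableEquiv_toLp_prod _ _)

theorem integral_zx_zxi {d : ℕ}
    (F : EuclideanSpace ℝ (Fin d) × EuclideanSpace ℝ (Fin d) → ℂ) :
    ∫ z : EuclideanSpace ℝ (Fin (d + d)), F (zx z, zxi z) = ∫ p, F p ∂(volume.prod volume) :=
  (measurePreserving_splitEquiv d).integral_comp' F

theorem inner_mk2 {d : ℕ} (z : EuclideanSpace ℝ (Fin (d + d)))
    (ξ x : EuclideanSpace ℝ (Fin d)) :
    inner ℝ z (mk2 ξ x) = inner ℝ (zx z) ξ + inner ℝ (zxi z) x := by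
  simp [PiLp.inner_apply, mk2, zx, zxi, Fin.sum_univ_add, -Fin.natAdd_eq_addNat]

/-- Conjugated Fourier inversion for Schwartz functions. -/
theorem integral_conj_fourier_mul_exp {d : ℕ}
    (g : SchwartzMap (EuclideanSpace ℝ (Fin d)) ℂ) (y : EuclideanSpace ℝ (Fin d)) :
    ∫ ω, (starRingEnd ℂ) (𝓕 (⇑g) ω) *
      Complex.exp (-(2 * Real.pi * Complex.I) * (inner ℝ ω y : ℝ)) =
      (starRingEnd ℂ) (g y) := by
  have hinv : 𝓕⁻ (𝓕 (⇑g)) y = g y :=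
    congrFun (g.continuous.fourierInv_fourier_eq g.integrable (𝓕 g).integrable) y
  rw [← hinv, Real.fourierInv_eq', ← integral_conj]
  refine integral_congr_ae (.of_forall fun ω => ?_)
  simp only [smul_eq_mul, map_mul, ← Complex.exp_conj, Complex.conj_ofReal, Complex.conj_I]
  rw [mul_comm]
  congr 2
  push_cast
  ring

/-- A product of integrable functions of the two variables, modulated by a unimodular
exponential with continuous phase, is integrable. -/
theorem integrable_mul_exp_phase {α β : Type*} [TopologicalSpace α] [TopologicalSpace β]
    [SecondCountableTopology α] [SecondCountableTopology β]
    [MeasurableSpace α] [MeasurableSpace β] [BorelSpace α] [BorelSpace β]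
    {μ : Measure α} {ν : Measure β} [SFinite μ] [SFinite ν] {u : α → ℂ} {v : β → ℂ}
    (hu : Integrable u μ) (hv : Integrable v ν) {φ : α × β → ℝ} (hφ : Continuous φ) :
    Integrable (fun p : α × β => u p.1 * v p.2 * Complex.exp (φ p * Complex.I))
      (μ.prod ν) := by
  refine (hu.mul_prod hv).mul_bdd (c := 1) ?_ (.of_forall fun p => ?_)
  · exact Continuous.aestronglyMeasurable (by fun_prop)
  · rw [Complex.norm_exp_ofReal_mul_I]

/-- For Schwartz functions f, g on ℝ^d, the Fourier transform of the
Rihaczek distribution R(f,g) satisfies ℱ(R(f,g))(ξ, x) = V_g f(−x, ξ). -/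
theorem statement_10 {d : ℕ}
    (f g : SchwartzMap (EuclideanSpace ℝ (Fin d)) ℂ) :
    ∀ ξ x : EuclideanSpace ℝ (Fin d),
      𝓕 (rihaczek (⇑f) (⇑g)) (mk2 ξ x) = stft (⇑g) (⇑f) (-x) ξ := by
  intro ξ x
  have hconj : Integrable fun ω => (starRingEnd ℂ) (𝓕 (⇑g) ω) :=
    Complex.conjCLE.integrable_comp_iff.2 (𝓕 g).integrable
  set F : EuclideanSpace ℝ (Fin d) × EuclideanSpace ℝ (Fin d) → ℂ := fun p =>
    f p.1 * (starRingEnd ℂ) (𝓕 (⇑g) p.2) *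
      Complex.exp ((-2 * Real.pi *
        (inner ℝ p.1 p.2 + (inner ℝ p.1 ξ + inner ℝ p.2 x)) : ℝ) * Complex.I) with hF
  have hint : Integrable F (volume.prod volume) :=
    integrable_mul_exp_phase f.integrable hconj (by fun_prop)
  calc 𝓕 (rihaczek (⇑f) (⇑g)) (mk2 ξ x)
      = ∫ z : EuclideanSpace ℝ (Fin (d + d)), F (zx z, zxi z) := by
        rw [Real.fourier_eq']
        refine integral_congr_ae (.of_forall fun z => ?_)
        simp only [hF, rihaczek, inner_mk2, smul_eq_mul]
        rw [mul_comm, mul_assoc, ← Complex.exp_add]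
        congr 2
        push_cast
        ring
    _ = ∫ t, ∫ ω, F (t, ω) := by rw [integral_zx_zxi, integral_prod F hint]
    _ = stft (⇑g) (⇑f) (-x) ξ := by
        refine integral_congr_ae (.of_forall fun t => ?_)
        simp only
        rw [sub_neg_eq_add, ← integral_conj_fourier_mul_exp g (t + x), mul_right_comm,
          ← integral_const_mul]
        refine integral_congr_ae (.of_forall fun ω => ?_)
        simp only [hF]
        rw [mul_mul_mul_comm, ← Complex.exp_add, inner_add_right, real_inner_comm ω t,
          real_inner_comm t ξ]
        congr 2
        push_cast
        ring
end
end
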